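/- Let d ≥ 2. There exists 0 < L < ∞ with the following property: whenever β, δ > 0 satisfy β - δ > L, then for every translation invariant, spin-flip symmetric interaction Ψ on Ω = {1,-1}^{Z^d} with |||Ψ|||' < δ, the interaction Φ = Φ^β + Ψ has at least two distinct translation-invariant Gibbs states (equivalently, more than one equilibrium state). -/

import Mathlib

open scoped BigOperators
open Real MeasureTheory Filter Topology

namespace Ising

/-- The lattice `ℤ^d`. -/
abbrev V (d : ℕ) := Fin d → ℤ
/-- Spin configurations on `ℤ^d`; `true` encodes spin `+1`, `false` encodes spin `-1`. -/
abbrev Config (d : ℕ) := V d → Bool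
/-- The ambient euclidean space `ℝ^d`. -/
abbrev Point (d : ℕ) := Fin d → ℝ

variable {d : ℕ}

noncomputable section

/-- The spin value (`±1`) of a boolean. -/
def spin (b : Bool) : ℝ := if b then 1 else -1

/-- An interaction assigns to each finite `Λ ⊆ ℤ^d` a function of configurations
(only the restriction to `Λ` is relevant; see `IsLocal`). -/
abbrev Interaction (d : ℕ) := Finset (V d) → Config d → ℝ

/-- `Φ_Λ` depends only on the restriction of the configuration to `Λ`. -/
def IsLocal (Φ : Interaction d) : Prop :=
  ∀ (Λ : Finset (V d)) (ω ω' : Config d), (∀ x ∈ Λ, ω x = ω' x) → Φ Λ ω = Φ Λ ω'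

/-- Translation of a configuration: `(τ^a ω)(x) = ω(x+a)`. -/
def translate (a : V d) (ω : Config d) : Config d := fun x => ω (x + a)

/-- Translation invariance of an interaction: `Φ_Λ(ω) = Φ_{Λ-a}(τ^a ω)`. -/
def TransInv (Φ : Interaction d) : Prop :=
  ∀ (a : V d) (Λ : Finset (V d)) (ω : Config d),
    Φ (Λ.image (fun x => x - a)) (translate a ω) = Φ Λ ω

/-- Spin-flip symmetry: `Ψ_Λ(ω) = Ψ_Λ(-ω)`. -/
def SpinFlipSymm (Ψ : Interaction d) : Prop :=
  ∀ (Λ : Finset (V d)) (ω : Config d), Ψ Λ (fun x => !(ω x)) = Ψ Λ ω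

/-- `sup_{ω ∈ Ω_Λ} |Φ_Λ(ω)|`. -/
def supNorm (Φ : Interaction d) (Λ : Finset (V d)) : ℝ := ⨆ ω : Config d, |Φ Λ ω|

/-- The summand of the norm `‖Φ‖`. -/
def normTerm (Φ : Interaction d) (Λ : Finset (V d)) : ℝ :=
  if (0 : V d) ∈ Λ then supNorm Φ Λ else 0

/-- `‖Φ‖ = Σ_{0 ∈ Λ ⋐ ℤ^d} sup_{ω} |Φ_Λ(ω)|`. -/
def anorm (Φ : Interaction d) : ℝ := ∑' Λ : Finset (V d), normTerm Φ Λ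

/-- Absolute summability of an interaction. -/
def AbsSummable (Φ : Interaction d) : Prop := Summable (normTerm Φ)

/-- `‖x-y‖_∞`. -/
def distInf (x y : V d) : ℕ := Finset.univ.sup fun i => (x i - y i).natAbs

/-- `‖x-y‖_1`. -/
def dist1 (x y : V d) : ℕ := ∑ i, (x i - y i).natAbs

/-- `diam(Λ) = sup {‖x-y‖_∞ : x, y ∈ Λ}`. -/
def diam (Λ : Finset (V d)) : ℕ := Λ.sup fun x => Λ.sup fun y => distInf x y

/-- The summand of the `d`-th order decaying norm `|||Ψ|||`. -/
def dTerm (Ψ : Interaction d) (Λ : Finset (V d)) : ℝ :=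
  if (0 : V d) ∈ Λ then ((diam Λ + 1 : ℕ) : ℝ) ^ d * supNorm Ψ Λ else 0

/-- `|||Ψ||| = Σ_{0 ∈ Λ ⋐ ℤ^d} (diam(Λ)+1)^d sup_{ω} |Ψ_Λ(ω)|`. -/
def dnorm (Ψ : Interaction d) : ℝ := ∑' Λ : Finset (V d), dTerm Ψ Λ

/-- Summability of the `d`-th order decaying norm. -/
def DSummable (Ψ : Interaction d) : Prop := Summable (dTerm Ψ)

/-- The summand of the norm `|||Ψ|||'`. -/
def dTerm' (Ψ : Interaction d) (Λ : Finset (V d)) : ℝ :=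
  if (0 : V d) ∈ Λ then (Λ.card : ℝ)⁻¹ * ((diam Λ + 1 : ℕ) : ℝ) ^ d * supNorm Ψ Λ else 0

/-- `|||Ψ|||' = Σ_{0 ∈ Λ ⋐ ℤ^d} |Λ|⁻¹ (diam(Λ)+1)^d sup_{ω} |Ψ_Λ(ω)|`. -/
def dnorm' (Ψ : Interaction d) : ℝ := ∑' Λ : Finset (V d), dTerm' Ψ Λ

/-- Summability of the norm `|||·|||'`. -/
def DSummable' (Ψ : Interaction d) : Prop := Summable (dTerm' Ψ)

/-- The Hamiltonian `H_{Φ,Λ}(ω) = Σ_{Δ ⋐ ℤ^d, Δ ∩ Λ ≠ ∅} Φ_Δ(ω|_Δ)`. -/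
def ham (Φ : Interaction d) (Λ : Finset (V d)) (ω : Config d) : ℝ :=
  ∑' Δ : Finset (V d), if (Δ ∩ Λ).Nonempty then Φ Δ ω else 0

/-- The configuration `ω_Λ ∨ η` agreeing with `f` on `Λ` and with `η` off `Λ`. -/
def fill (Λ : Finset (V d)) (f : ↥Λ → Bool) (η : Config d) : Config d :=
  fun x => if h : x ∈ Λ then f ⟨x, h⟩ else η x

/-- The partition function `Z^η_{Φ,Λ}`. -/
def gibbsZ (Φ : Interaction d) (Λ : Finset (V d)) (η : Config d) : ℝ :=
  ∑ f : ↥Λ → Bool, Real.exp (-(ham Φ Λ (fill Λ f η)))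

/-- The finite Gibbs state `μ^η_{Φ,Λ}({ω_Λ})`. -/
def finGibbs (Φ : Interaction d) (Λ : Finset (V d)) (η : Config d) (f : ↥Λ → Bool) : ℝ :=
  Real.exp (-(ham Φ Λ (fill Λ f η))) / gibbsZ Φ Λ η

/-- The cylinder set `{ξ : ξ|_Λ = f}`. -/
def cyl (Λ : Finset (V d)) (f : ↥Λ → Bool) : Set (Config d) :=
  {ξ | ∀ (x : V d) (h : x ∈ Λ), ξ x = f ⟨x, h⟩}

/-- `σ` is a Gibbs state for `Φ` (DLR condition): for each finite `Λ` there is a Borel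
probability measure on boundary conditions with respect to which `σ` of each cylinder
is the average of the finite Gibbs states. -/
def IsGibbs (Φ : Interaction d) (σ : Measure (Config d)) : Prop :=
  IsProbabilityMeasure σ ∧
  ∀ Λ : Finset (V d), ∃ ν : Measure (Config d), IsProbabilityMeasure ν ∧
    ∀ f : ↥Λ → Bool, (σ (cyl Λ f)).toReal = ∫ η, finGibbs Φ Λ η f ∂ν

/-- Translation invariance of a measure: `τ^a_* σ = σ`. -/
def MeasTransInv (σ : Measure (Config d)) : Prop :=
  ∀ a : V d, σ.map (translate a) = σ

/-- The Ising interaction at inverse temperature `β`: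
`Φ^β_Λ(ω) = -β ω(x) ω(y)` if `Λ = {x,y}` with `‖x-y‖₁ = 1`, and `0` otherwise. -/
def ising (β : ℝ) : Interaction d := fun Λ ω =>
  if Λ.card = 2 ∧ ∀ x ∈ Λ, ∀ y ∈ Λ, x ≠ y → dist1 x y = 1
  then -β * ∏ x ∈ Λ, spin (ω x) else 0

/-- The sum of two interactions. -/
def Iadd (Φ Ψ : Interaction d) : Interaction d := fun Λ ω => Φ Λ ω + Ψ Λ ω

/-- `S` is connected for the adjacency given by `ρ`-distance `1`. -/
def ConnectedBy (ρ : V d → V d → ℕ) (S : Set (V d)) : Prop :=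
  ∀ x ∈ S, ∀ y ∈ S, ∃ (n : ℕ) (p : ℕ → V d), p 0 = x ∧ p n = y ∧
    (∀ i ≤ n, p i ∈ S) ∧ ∀ i < n, ρ (p i) (p (i+1)) = 1

/-- `‖·‖₁`-connectedness. -/
def Conn1 (S : Set (V d)) : Prop := ConnectedBy dist1 S

/-- `‖·‖_∞`-connectedness. -/
def ConnInf (S : Set (V d)) : Prop := ConnectedBy distInf S

/-- A finite set `Λ` is c-connected if both `Λ` and its complement are `‖·‖_∞`-connected. -/
def CConn (Λ : Finset (V d)) : Prop :=
  ConnInf (↑Λ : Set (V d)) ∧ ConnInf ((↑Λ : Set (V d))ᶜ)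

/-- `Ψ` vanishes on sets that are not `‖·‖₁`-connected. -/
def ZeroOnNonConn (Ψ : Interaction d) : Prop :=
  ∀ Λ : Finset (V d), ¬ Conn1 (↑Λ : Set (V d)) → ∀ ω, Ψ Λ ω = 0

/-- The closed unit cube `I_x` centered at `x ∈ ℤ^d`. -/
def cube (x : V d) : Set (Point d) := {y | ∀ i, |y i - (x i : ℝ)| ≤ 1/2}

/-- `M(S) = ⋃_{x ∈ S} I_x`. -/
def cubes (S : Set (V d)) : Set (Point d) := ⋃ x ∈ S, cube x

/-- A contour is the boundary `∂M(S)` of `M(S)` for a finite c-connected `S`. -/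
def IsContour (γ : Set (Point d)) : Prop :=
  ∃ S : Finset (V d), CConn S ∧ γ = frontier (cubes ↑S)

/-- The set of sites with spin `-1`. -/
def minusSet (ω : Config d) : Set (V d) := {x | ω x = false}

/-- `Γ(ω)`: the connected components of `∂M({x : ω(x) = -1})`. -/
def Gamma (ω : Config d) : Set (Set (Point d)) :=
  {γ | ∃ y ∈ frontier (cubes (minusSet ω)),
    γ = connectedComponentIn (frontier (cubes (minusSet ω))) y}

/-- The `(d-1)`-dimensional face of the unit cubes lying between `x` and `x + e_i`. -/
def face (x : V d) (i : Fin d) : Set (Point d) :=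
  {y | y i = (x i : ℝ) + 1/2 ∧ ∀ j, j ≠ i → |y j - (x j : ℝ)| ≤ 1/2}

/-- A plaquette is a `(d-1)`-dimensional face of one of the cubes `I_x`. -/
def IsPlaquette (P : Set (Point d)) : Prop := ∃ x i, P = face x i

/-- `|γ|`: the number of plaquettes contained in `γ`. -/
def csize (γ : Set (Point d)) : ℕ :=
  Nat.card {P : Set (Point d) // IsPlaquette P ∧ P ⊆ γ}

/-- The constant `+1` configuration. -/
def plusC : Config d := fun _ => true

/-- The constant `-1` configuration. -/
def minusC : Config d := fun _ => false

open scoped Classical in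
/-- The finite-volume Gibbs probability (with boundary condition `η`) of an event
`A`: `μ^η_{Φ,Λ}({ω : ω ∨ η ∈ A})`. -/
def bcProb (Φ : Interaction d) (Λ : Finset (V d)) (η : Config d) (A : Set (Config d)) : ℝ :=
  (∑ f : ↥Λ → Bool, if fill Λ f η ∈ A then Real.exp (-(ham Φ Λ (fill Λ f η))) else 0) /
    gibbsZ Φ Λ η

/-- `ω ∈ Ω_Λ^+`, i.e. `ω` is `+1` off `Λ`. -/
def plusOutside (Λ : Finset (V d)) (ω : Config d) : Prop := ∀ x, x ∉ Λ → ω x = true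

/-- The configuration obtained by flipping all spins in `S`. -/
def flipOn (S : Finset (V d)) (ω : Config d) : Config d :=
  fun x => if x ∈ S then !(ω x) else ω x

/-- `|𝓔_Λ|`: the number of nearest-neighbour edges meeting `Λ`. -/
def edgeCount (Λ : Finset (V d)) : ℕ :=
  Nat.card {e : Finset (V d) // (∃ x y, e = {x, y} ∧ dist1 x y = 1) ∧ (e ∩ Λ).Nonempty}

/-- `R` is a (nonempty) rectangle in `ℤ^d`. -/
def IsRect (R : Finset (V d)) : Prop := ∃ a b : V d, a ≤ b ∧ R = Finset.Icc a b

/-- `R(Λ)`: the minimal rectangle containing `Λ`. -/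
def minRect (Λ : Finset (V d)) : Finset (V d) :=
  if h : Λ.Nonempty then
    Finset.Icc (fun i => Λ.inf' h fun x => x i) (fun i => Λ.sup' h fun x => x i)
  else ∅

open scoped Classical in
/-- The rectangle regrouping `Ψ̃` of `Ψ`: `Ψ̃_R(ω) = Σ_{Λ : R(Λ) = R} Ψ_Λ(ω|_Λ)` for
rectangles `R`, and `Ψ̃_Λ = 0` for non-rectangles. -/
def regroup (Ψ : Interaction d) : Interaction d := fun R ω =>
  if IsRect R then ∑ Λ ∈ R.powerset, (if minRect Λ = R then Ψ Λ ω else 0) else 0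



/-! ### Part A: contours -/

/-- The `i`-th unit vector. -/
def ev (i : Fin d) : V d := Pi.single i 1

/-- An edge `(y, i)` stands for `{y, y + e_i}`. -/
abbrev Edge (d : ℕ) := V d × Fin d

/-- Indicator of an edge in `ZMod 2`. -/
def eind (P : Finset (Edge d)) (e : Edge d) : ZMod 2 := if e ∈ P then 1 else 0

/-- Ray parity count. -/
def rayCnt (i0 : Fin d) (P : Finset (Edge d)) (x : V d) : ZMod 2 :=
  ∑ e ∈ P, if (e.2 = i0 ∧ x i0 ≤ e.1 i0 ∧ ∀ j, j ≠ i0 → e.1 j = x j) then 1 else 0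

lemma ev_same (i : Fin d) : ev i i = 1 := by simp [ev]
lemma ev_ne {i j : Fin d} (h : j ≠ i) : ev i j = 0 := by simp [ev, h]

lemma ray_step (i0 : Fin d) (P : Finset (Edge d)) (x : V d) :
    rayCnt i0 P x = eind P (x, i0) + rayCnt i0 P (x + ev i0) := by
  have h1 : eind P (x, i0) = ∑ e ∈ P, if (x, i0) = e then (1 : ZMod 2) else 0 := by
    rw [Finset.sum_ite_eq]; rfl
  rw [h1]
  unfold rayCnt
  rw [← Finset.sum_add_distrib]
  refine Finset.sum_congr rfl fun e _ => ?_
  obtain ⟨y, i⟩ := e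
  by_cases hi : i = i0
  · subst hi
    by_cases hj : ∀ j, j ≠ i → y j = x j
    · have hj' : ∀ j, j ≠ i → y j = (x + ev i) j := by
        intro j hji; simp [hj j hji, ev_ne hji]
      have hxy : ((x, i) = (y, i)) ↔ x i = y i := by
        constructor
        · intro h; rw [(Prod.mk.inj h).1]
        · intro h
          have : x = y := by
            funext j
            by_cases hji : j = i
            · subst hji; exact h
            · exact (hj j hji).symm
          rw [this]
      have e1 : (x + ev i) i = x i + 1 := by simp [ev_same]
      have c1 : ((y, i).2 = i ∧ x i ≤ (y, i).1 i ∧ ∀ j, j ≠ i → (y, i).1 j = x j) ↔ x i ≤ y i :=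
        ⟨fun h => h.2.1, fun h => ⟨rfl, h, hj⟩⟩
      have c2 : ((y, i).2 = i ∧ (x + ev i) i ≤ (y, i).1 i ∧
          ∀ j, j ≠ i → (y, i).1 j = (x + ev i) j) ↔ x i + 1 ≤ y i := by
        rw [e1]
        exact ⟨fun h => h.2.1, fun h => ⟨rfl, h, hj'⟩⟩
      rw [if_congr c1 rfl rfl, if_congr c2 rfl rfl, if_congr hxy rfl rfl]
      by_cases h1 : x i = y i
      · simp [h1]
      · by_cases h2 : x i ≤ y i
        · have : x i + 1 ≤ y i := by omega
          simp [h1, h2, this]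
        · have : ¬ x i + 1 ≤ y i := by omega
          simp [h1, h2, this]
    · have hj' : ¬ ∀ j, j ≠ i → y j = (x + ev i) j := by
        intro h; apply hj
        intro j hji; simp [h j hji, ev_ne hji]
      have hxy : ¬ ((x, i) = (y, i)) := by
        intro h; apply hj; intro j _; rw [(Prod.mk.inj h).1]
      rw [if_neg (fun h => hj h.2.2), if_neg hxy, if_neg (fun h => hj' h.2.2), add_zero]
  · have : ¬ ((x, i0) = (y, i)) := by
      intro h; exact hi (Prod.mk.inj h).2.symm
    simp [hi, this]

lemma ray_zero (i0 : Fin d) (P : Finset (Edge d)) (x : V d)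
    (h : ∀ e ∈ P, e.1 i0 < x i0) : rayCnt i0 P x = 0 := by
  apply Finset.sum_eq_zero
  intro e he
  rw [if_neg]
  rintro ⟨_, h2, _⟩
  have := h e he
  omega

/-- downward induction along `e_{i0}` -/
lemma down_ind (i0 : Fin d) (C : V d → Prop) (N : ℤ) (h0 : ∀ x, N ≤ x i0 → C x)
    (h1 : ∀ x, C (x + ev i0) → C x) (x : V d) : C x := by
  have key : ∀ n : ℕ, ∀ x : V d, N ≤ x i0 + n → C x := by
    intro n
    induction n with
    | zero => intro x hx; exact h0 x (by simpa using hx)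
    | succ n ih =>
      intro x hx
      apply h1; apply ih
      simp only [Pi.add_apply, ev_same]; push_cast at hx; linarith
  exact key (N - x i0).toNat x (by have := Int.self_le_toNat (N - x i0); linarith)

lemma exists_bound (i0 : Fin d) (P : Finset (Edge d)) : ∃ N : ℤ, ∀ e ∈ P, e.1 i0 < N := by
  obtain ⟨N, hN⟩ := (P.image fun e => e.1 i0).bddAbove
  refine ⟨N + 1, fun e he => ?_⟩
  have := hN (Finset.mem_coe.2 (Finset.mem_image_of_mem (fun e => e.1 i0) he))
  omega

lemma z2 (a b c e f g h : ZMod 2) (h1 : a = b + c) (h2 : e = f + g) (h3 : c + g = h) :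
    a + e = b + f + h := by
  rw [h1, h2, ← h3]; ring

lemma z2_two (a : ZMod 2) : a + a = 0 := by revert a; decide

lemma ray_d (i0 : Fin d) (P : Finset (Edge d))
    (hsq : ∀ (y : V d) (i j : Fin d), i ≠ j →
      eind P (y, i) + eind P (y, j) + eind P (y + ev i, j) + eind P (y + ev j, i) = 0)
    (x : V d) (j : Fin d) : rayCnt i0 P x + rayCnt i0 P (x + ev j) = eind P (x, j) := by
  by_cases hj : j = i0
  · subst hj
    rw [ray_step j P x, add_assoc, z2_two, add_zero]
  obtain ⟨N, hN⟩ := exists_bound i0 P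
  refine down_ind i0 (fun x => rayCnt i0 P x + rayCnt i0 P (x + ev j) = eind P (x, j)) N ?_ ?_ x
  · intro x hx
    rw [ray_zero, ray_zero, eind, if_neg]
    · simp
    · intro h; have := hN _ h; simp only at this; omega
    · intro e he; have := hN e he
      simp only [Pi.add_apply, ev_ne (Ne.symm hj)]; omega
    · intro e he; have := hN e he; omega
  · intro x ih
    rw [add_right_comm] at ih
    rw [z2 _ _ _ _ _ _ _ (ray_step i0 P x) (ray_step i0 P (x + ev j)) ih]
    have := hsq x i0 j (Ne.symm hj)
    clear ih hN hsq
    generalize eind P (x, i0) = a at *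
    generalize eind P (x, j) = b at *
    generalize eind P (x + ev i0, j) = c at *
    generalize eind P (x + ev j, i0) = e at *
    revert a b c e; decide

/-- indicator of minus -/
def mind (ω : Config d) (x : V d) : ZMod 2 := if ω x = false then 1 else 0

/-- disagreement edges of `ω` -/
def dis (ω : Config d) (e : Edge d) : Prop := ω e.1 ≠ ω (e.1 + ev e.2)

/-- Two edges are near if their base points are at sup distance at most one. -/
def near (a b : Edge d) : Prop := ∀ k, |a.1 k - b.1 k| ≤ 1

lemma near_symm {a b : Edge d} (h : near a b) : near b a := by
  intro k; rw [abs_sub_comm]; exact h k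

/-- step relation in `E` -/
def stp (E : Finset (Edge d)) (a b : Edge d) : Prop := a ∈ E ∧ b ∈ E ∧ near a b

open scoped Classical in
/-- component of `e` in `E` -/
def comp (E : Finset (Edge d)) (e : Edge d) : Finset (Edge d) :=
  E.filter (fun e' => Relation.ReflTransGen (stp E) e e')

lemma mem_comp {E : Finset (Edge d)} {e e' : Edge d} :
    e' ∈ comp E e ↔ e' ∈ E ∧ Relation.ReflTransGen (stp E) e e' := by
  classical
  simp [comp]

lemma rtg_symm {E : Finset (Edge d)} {e e' : Edge d}
    (h : Relation.ReflTransGen (stp E) e e') : Relation.ReflTransGen (stp E) e' e := by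
  induction h with
  | refl => exact .refl
  | tail _ hbc ih => exact .head ⟨hbc.2.1, hbc.1, near_symm hbc.2.2⟩ ih

lemma comp_eq {E : Finset (Edge d)} {e e' : Edge d} (h : e' ∈ comp E e) :
    comp E e' = comp E e := by
  rw [mem_comp] at h
  ext a
  simp only [mem_comp]
  refine and_congr_right fun _ => ⟨fun h1 => h.2.trans h1, fun h1 => (rtg_symm h.2).trans h1⟩

lemma self_mem_comp {E : Finset (Edge d)} {e : Edge d} (h : e ∈ E) : e ∈ comp E e :=
  mem_comp.2 ⟨h, .refl⟩

/-- Growth connectedness. -/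
def GConn (K : Finset (Edge d)) : Prop :=
  ∀ P ⊆ K, P.Nonempty → P ≠ K → ∃ a ∈ P, ∃ b ∈ K, b ∉ P ∧ near a b

lemma rtg_cross {α : Type*} {r : α → α → Prop} {p q : α} (h : Relation.ReflTransGen r p q)
    (S : α → Prop) (hp : S p) (hq : ¬ S q) : ∃ a b, r a b ∧ S a ∧ ¬ S b := by
  induction h with
  | refl => exact absurd hp hq
  | @tail b c _ hbc ih =>
    by_cases hb : S b
    · exact ⟨b, c, hbc, hb, hq⟩
    · exact ih hb

lemma comp_gconn (E : Finset (Edge d)) (e : Edge d) : GConn (comp E e) := by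
  intro P hP hne hneq
  obtain ⟨p, hp⟩ := hne
  obtain ⟨q, hq, hqP⟩ : ∃ q ∈ comp E e, q ∉ P := by
    by_contra hcon
    push Not at hcon
    exact hneq (Finset.Subset.antisymm hP hcon)
  have hpc := hP hp
  have hr : Relation.ReflTransGen (stp E) p q :=
    (rtg_symm (mem_comp.1 hpc).2).trans (mem_comp.1 hq).2
  obtain ⟨a, b, hab, ha, hb⟩ := rtg_cross hr (fun t => t ∈ P) hp hqP
  refine ⟨a, ha, b, ?_, hb, hab.2.2⟩
  exact mem_comp.2 ⟨hab.2.1, (mem_comp.1 (hP ha)).2.tail hab⟩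

lemma ev_mem01 (i k : Fin d) : ev i k = 0 ∨ ev i k = 1 := by
  by_cases h : k = i
  · subst h; right; exact ev_same k
  · left; exact ev_ne h

lemma near_sq (y : V d) (i j : Fin d) : ∀ a ∈ ({(y, i), (y, j), (y + ev i, j), (y + ev j, i)} : Set (Edge d)),
    ∀ b ∈ ({(y, i), (y, j), (y + ev i, j), (y + ev j, i)} : Set (Edge d)), near a b := by
  intro a ha b hb k
  simp only [Set.mem_insert_iff, Set.mem_singleton_iff] at ha hb
  rcases ev_mem01 i k with hi | hi <;> rcases ev_mem01 j k with hj | hj <;>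
  rcases ha with rfl | rfl | rfl | rfl <;> rcases hb with rfl | rfl | rfl | rfl <;>
    simp [hi, hj]

lemma dis_eind (ω : Config d) (E : Finset (Edge d)) (hE : ∀ e, e ∈ E ↔ dis ω e) (y : V d)
    (i : Fin d) : eind E (y, i) = mind ω y + mind ω (y + ev i) := by
  simp only [eind, hE, dis, mind]
  cases ω y <;> cases ω (y + ev i) <;> simp <;> decide

lemma comp_sq (ω : Config d) (E : Finset (Edge d)) (hE : ∀ e, e ∈ E ↔ dis ω e) (e0 : Edge d)
    (y : V d) (i j : Fin d) :
    eind (comp E e0) (y, i) + eind (comp E e0) (y, j) + eind (comp E e0) (y + ev i, j)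
      + eind (comp E e0) (y + ev j, i) = 0 := by
  set Q : Set (Edge d) := {(y, i), (y, j), (y + ev i, j), (y + ev j, i)} with hQ
  by_cases h : ∃ a ∈ Q, a ∈ comp E e0
  · obtain ⟨a, haQ, ha⟩ := h
    have key : ∀ b ∈ Q, eind (comp E e0) b = eind E b := by
      intro b hb
      have : b ∈ comp E e0 ↔ b ∈ E := by
        refine ⟨fun h => (mem_comp.1 h).1, fun h => mem_comp.2 ⟨h, ?_⟩⟩
        exact (mem_comp.1 ha).2.tail ⟨(mem_comp.1 ha).1, h, near_sq y i j a haQ b hb⟩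
      simp only [eind, this]
    rw [key (y, i) (by simp [hQ]), key (y, j) (by simp [hQ]), key (y + ev i, j) (by simp [hQ]),
      key (y + ev j, i) (by simp [hQ]), dis_eind ω E hE, dis_eind ω E hE, dis_eind ω E hE,
      dis_eind ω E hE, add_right_comm y (ev j) (ev i)]
    generalize mind ω y = a
    generalize mind ω (y + ev i) = b
    generalize mind ω (y + ev j) = c
    generalize mind ω (y + ev i + ev j) = e
    revert a b c e; decide
  · push Not at h
    have key : ∀ b ∈ Q, eind (comp E e0) b = 0 := by
      intro b hb; rw [eind, if_neg (h b hb)]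
    rw [key (y, i) (by simp [hQ]), key (y, j) (by simp [hQ]), key (y + ev i, j) (by simp [hQ]),
      key (y + ev j, i) (by simp [hQ])]
    simp

/-- parity: the ray count of all disagreement edges is the minus indicator -/
lemma ray_mind (i0 : Fin d) (ω : Config d) (E : Finset (Edge d)) (hE : ∀ e, e ∈ E ↔ dis ω e)
    (N : ℤ) (hN : ∀ x, N ≤ x i0 → ω x = true) (x : V d) : rayCnt i0 E x = mind ω x := by
  obtain ⟨N', hN'⟩ := exists_bound i0 E
  refine down_ind i0 (fun x => rayCnt i0 E x = mind ω x) (max N N') ?_ ?_ x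
  · intro x hx
    rw [ray_zero, mind, hN x (le_trans (le_max_left _ _) hx)]
    · simp
    · intro e he
      exact lt_of_lt_of_le (hN' e he) (le_trans (le_max_right _ _) hx)
  · intro x ih
    rw [ray_step, ih, dis_eind ω E hE, add_assoc, z2_two, add_zero]

lemma exists_comp (i0 : Fin d) (E : Finset (Edge d)) (x : V d) (h : rayCnt i0 E x ≠ 0) :
    ∃ e ∈ E, rayCnt i0 (comp E e) x ≠ 0 := by
  by_contra hcon
  push Not at hcon
  apply h
  unfold rayCnt
  rw [← Finset.sum_fiberwise_of_maps_to (t := E.image (comp E)) (g := comp E)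
    (fun e he => Finset.mem_image_of_mem _ he)]
  apply Finset.sum_eq_zero
  intro K hK
  obtain ⟨e, he, rfl⟩ := Finset.mem_image.1 hK
  refine Eq.trans ?_ (hcon e he)
  unfold rayCnt
  refine Finset.sum_congr ?_ (fun _ _ => rfl)
  ext a
  rw [Finset.mem_filter]
  constructor
  · rintro ⟨ha, hc⟩; rw [← hc]; exact self_mem_comp ha
  · intro ha; exact ⟨(mem_comp.1 ha).1, comp_eq ha⟩

/-- Sites inside the contour. -/
def inside (i0 : Fin d) (B : Finset (V d)) (P : Finset (Edge d)) : Finset (V d) :=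
  B.filter (fun y => rayCnt i0 P y = 1)

lemma z2_ne (a : ZMod 2) : a ≠ 0 ↔ a = 1 := by revert a; decide

lemma z2_walk (F : V d → ZMod 2) (P : Finset (Edge d))
    (hd : ∀ x j, F x + F (x + ev j) = eind P (x, j)) (j : Fin d) (x : V d)
    (hno : ∀ m : ℕ, (x + m • ev j, j) ∉ P) (n : ℕ) : F (x + n • ev j) = F x := by
  induction n with
  | zero => simp
  | succ n ih =>
    have := hd (x + n • ev j) j
    rw [eind, if_neg (hno n), ih] at this
    rw [succ_nsmul, ← add_assoc]
    clear ih hno hd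
    generalize F x = a at *
    generalize F (x + n • ev j + ev j) = b at *
    revert a b; decide

lemma nsmul_ev_same (n : ℕ) (i : Fin d) : (n • ev i) i = (n : ℤ) := by simp [ev_same]
lemma nsmul_ev_ne (n : ℕ) {i j : Fin d} (h : j ≠ i) : (n • ev i) j = 0 := by simp [ev_ne h]

theorem contour_exists (i0 i1 : Fin d) (h01 : i0 ≠ i1) (l u : V d) (ω : Config d)
    (hω : ∀ x, x ∉ Finset.Icc l u → ω x = true) (x : V d) (hx : ω x = false) :
    ∃ P : Finset (Edge d), GConn P ∧ (∀ e ∈ P, dis ω e) ∧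
      (∀ e : Edge d, e ∈ P ↔ ¬ (e.1 ∈ inside i0 (Finset.Icc l u) P ↔
        e.1 + ev e.2 ∈ inside i0 (Finset.Icc l u) P)) ∧
      ∃ k : ℕ, k < P.card ∧ (x + k • ev i0, i0) ∈ P := by
  classical
  have hfin : {e : Edge d | dis ω e}.Finite := by
    apply Set.Finite.subset (Finset.finite_toSet
      ((Finset.Icc (l - 1) u) ×ˢ (Finset.univ : Finset (Fin d))))
    rintro ⟨y, i⟩ h
    simp only [Finset.coe_product, Finset.coe_univ, Set.mem_prod, Set.mem_univ, and_true,
      Finset.mem_coe, Finset.mem_Icc]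
    by_contra hcon
    apply h
    have h1 : y ∉ Finset.Icc l u := by
      rw [Finset.mem_Icc]; rintro ⟨a, b⟩
      refine hcon ⟨?_, b⟩
      intro k; have : l k ≤ y k := a k
      simp only [Pi.sub_apply, Pi.one_apply]; omega
    have h2 : y + ev i ∉ Finset.Icc l u := by
      rw [Finset.mem_Icc]; rintro ⟨a, b⟩
      refine hcon ⟨?_, ?_⟩
      · intro k; have := a k; rcases ev_mem01 i k with h | h <;> simp [h] at this ⊢ <;> omega
      · intro k; have := b k; rcases ev_mem01 i k with h | h <;> simp [h] at this ⊢ <;> omega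
    simp only; rw [hω _ h1, hω _ h2]
  set E := hfin.toFinset with hEdef
  have hE : ∀ e, e ∈ E ↔ dis ω e := by intro e; simp [hEdef]
  have hN : ∀ x : V d, u i0 + 1 ≤ x i0 → ω x = true := by
    intro x hx; apply hω; rw [Finset.mem_Icc]; rintro ⟨_, h⟩
    have : x i0 ≤ u i0 := h i0
    omega
  have hm : rayCnt i0 E x ≠ 0 := by
    rw [ray_mind i0 ω E hE _ hN, mind, if_pos hx]; decide
  obtain ⟨e0, he0, hray⟩ := exists_comp i0 E x hm
  set P := comp E e0 with hP
  have hPdis : ∀ e ∈ P, dis ω e := fun e he => (hE e).1 (mem_comp.1 he).1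
  have hd : ∀ x j, rayCnt i0 P x + rayCnt i0 P (x + ev j) = eind P (x, j) :=
    ray_d i0 P (fun y i j _ => comp_sq ω E hE e0 y i j)
  have hout_edge : ∀ (y : V d) (i : Fin d), y ∉ Finset.Icc l u → y + ev i ∉ Finset.Icc l u →
      (y, i) ∉ P := by
    intro y i h1 h2 h3
    apply hPdis _ h3
    simp only; rw [hω _ h1, hω _ h2]
  -- rays that miss the box
  have hmiss : ∀ (y : V d) (j : Fin d), (∀ m : ℕ, y + m • ev j ∉ Finset.Icc l u) →
      ∀ n : ℕ, rayCnt i0 P (y + n • ev j) = rayCnt i0 P y := by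
    intro y j h n
    refine z2_walk _ P hd j y (fun m => hout_edge _ _ (h m) ?_) n
    have := h (m + 1)
    rwa [succ_nsmul, ← add_assoc] at this
  obtain ⟨N, hNb⟩ := exists_bound i0 P
  have hfar : ∀ y : V d, (∀ m : ℕ, y + m • ev i0 ∉ Finset.Icc l u) → rayCnt i0 P y = 0 := by
    intro y h
    rw [← hmiss y i0 h (N - y i0).toNat]
    apply ray_zero
    intro e he
    have h1 := hNb e he
    simp only [Pi.add_apply, nsmul_ev_same]
    have := Int.self_le_toNat (N - y i0)
    omega
  have hfar1 : ∀ y : V d, u i1 < y i1 → rayCnt i0 P y = 0 := by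
    intro y hy
    apply hfar
    intro m hmem
    have := (Finset.mem_Icc.1 hmem).2 i1
    simp only [Pi.add_apply, nsmul_ev_ne m (Ne.symm h01)] at this
    omega
  have hout : ∀ y : V d, y ∉ Finset.Icc l u → rayCnt i0 P y = 0 := by
    intro y hy
    by_cases h : y i0 < l i0
    · have := hmiss y i1 (by
        intro m hmem
        have := (Finset.mem_Icc.1 hmem).1 i0
        simp only [Pi.add_apply, nsmul_ev_ne m h01] at this
        omega) (u i1 + 1 - y i1).toNat
      rw [← this]
      apply hfar1
      simp only [Pi.add_apply, nsmul_ev_same]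
      have := Int.self_le_toNat (u i1 + 1 - y i1)
      omega
    · apply hfar
      intro m hmem
      apply hy
      rw [Finset.mem_Icc] at hmem ⊢
      refine ⟨fun k => ?_, fun k => ?_⟩
      · by_cases hk : k = i0
        · subst hk; exact not_lt.1 h
        · have := hmem.1 k
          simpa [nsmul_ev_ne m hk, ev_ne hk] using this
      · have := hmem.2 k
        by_cases hk : k = i0
        · subst hk
          simp only [Pi.add_apply, nsmul_ev_same] at this
          show y k ≤ u k
          omega
        · simpa [nsmul_ev_ne m hk, ev_ne hk] using this
  have hins : ∀ y, y ∈ inside i0 (Finset.Icc l u) P ↔ rayCnt i0 P y = 1 := by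
    intro y
    rw [inside, Finset.mem_filter]
    refine ⟨fun h => h.2, fun h => ⟨?_, h⟩⟩
    by_contra hc
    rw [hout y hc] at h
    exact absurd h (by decide)
  refine ⟨P, comp_gconn E e0, hPdis, ?_, ?_⟩
  · rintro ⟨y, i⟩
    rw [hins, hins]
    have := hd y i
    simp only [eind] at this
    simp only
    by_cases hm : (y, i) ∈ P
    · simp only [hm, if_true] at this
      simp only [hm, true_iff]
      generalize rayCnt i0 P y = a at *
      generalize rayCnt i0 P (y + ev i) = b at *
      revert a b; decide
    · simp only [hm, if_false] at this
      simp only [hm, false_iff, not_not]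
      generalize rayCnt i0 P y = a at *
      generalize rayCnt i0 P (y + ev i) = b at *
      revert a b; decide
  · have hex : ∃ k : ℕ, (x + k • ev i0, i0) ∈ P := by
      by_contra hcon
      push Not at hcon
      apply hray
      have h := z2_walk _ P hd i0 x hcon (N - x i0).toNat
      rw [← h]
      apply ray_zero
      intro e he
      have h1 := hNb e he
      simp only [Pi.add_apply, nsmul_ev_same]
      have := Int.self_le_toNat (N - x i0)
      omega
    refine ⟨Nat.find hex, ?_, Nat.find_spec hex⟩
    have hone : ∀ j : ℕ, j ≤ Nat.find hex → rayCnt i0 P (x + j • ev i0) = 1 := by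
      intro j
      induction j with
      | zero => intro _; simpa using (z2_ne _).1 hray
      | succ j ih =>
        intro hj
        have h1 := ih (by omega)
        have h2 := Nat.find_min hex (m := j) (by omega)
        have h3 := hd (x + j • ev i0) i0
        rw [eind, if_neg h2, h1] at h3
        rw [succ_nsmul, ← add_assoc]
        generalize rayCnt i0 P (x + j • ev i0 + ev i0) = b at *
        revert b; decide
    have hj : ∀ j : ℕ, j ≤ Nat.find hex → ∃ e ∈ P, e.1 i0 = x i0 + j := by
      intro j hj
      by_contra hcon
      push Not at hcon
      have h := z2_walk _ P hd i1 (x + j • ev i0) (by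
        intro m hmem
        apply hcon _ hmem
        simp only [Pi.add_apply, nsmul_ev_same, nsmul_ev_ne m h01]; omega)
        (u i1 + 1 - (x + j • ev i0) i1).toNat
      rw [hone j hj, hfar1] at h
      · exact absurd h (by decide)
      · rw [Pi.add_apply _ _ i1, nsmul_ev_same]
        have := Int.self_le_toNat (u i1 + 1 - (x + j • ev i0) i1)
        omega
    choose φ0 hφ1 hφ2 using hj
    set φ : ℕ → Edge d := fun j => if h : j ≤ Nat.find hex then φ0 j h else e0 with hφ
    replace hφ1 : ∀ j, j ≤ Nat.find hex → φ j ∈ P := by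
      intro j hj; simp only [hφ, hj, dif_pos]; exact hφ1 j hj
    replace hφ2 : ∀ j, j ≤ Nat.find hex → (φ j).1 i0 = x i0 + j := by
      intro j hj; simp only [hφ, hj, dif_pos]; exact hφ2 j hj
    have : (Finset.range (Nat.find hex + 1)).card ≤ P.card := by
      apply Finset.card_le_card_of_injOn φ
      · intro j hj
        exact hφ1 j (by simpa [Nat.lt_succ_iff] using hj)
      · intro a ha b hb hab
        have h1 := hφ2 a (by simpa [Nat.lt_succ_iff] using ha)
        have h2 := hφ2 b (by simpa [Nat.lt_succ_iff] using hb)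
        rw [hab, h2] at h1
        omega
    rw [Finset.card_range] at this
    omega

/-! ### Part B: counting contours -/

/-- Edges near a given edge. -/
def nbrs (e : Edge d) : Finset (Edge d) :=
  (Finset.Icc (e.1 - 1) (e.1 + 1)) ×ˢ Finset.univ

lemma mem_nbrs {a b : Edge d} (h : near a b) : b ∈ nbrs a := by
  simp only [nbrs, Finset.mem_product, Finset.mem_univ, and_true, Finset.mem_Icc]
  refine ⟨fun k => ?_, fun k => ?_⟩
  · have := abs_le.1 (h k)
    simp only [Pi.sub_apply, Pi.one_apply]; omega
  · have := abs_le.1 (h k)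
    simp only [Pi.add_apply, Pi.one_apply]; omega

lemma card_nbrs (e : Edge d) : (nbrs e).card = 3 ^ d * d := by
  simp only [nbrs, Finset.card_product, Finset.card_univ, Fintype.card_fin, Pi.card_Icc]
  congr 1
  rw [Finset.prod_congr rfl (g := fun _ => 3)]
  · simp
  · intro i _
    simp only [Pi.sub_apply, Pi.add_apply, Pi.one_apply, Int.card_Icc]
    omega

/-- Chains of `m` steps starting at `e`. -/
def chains : ℕ → Edge d → Finset (List (Edge d))
  | 0, e => {[e]}
  | (m + 1), e => (nbrs e).biUnion fun e' => (chains m e').image (fun l => e :: l)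

lemma card_chains (m : ℕ) (e : Edge d) : (chains m e).card ≤ (3 ^ d * d) ^ m := by
  induction m generalizing e with
  | zero => simp [chains]
  | succ m ih =>
    rw [chains]
    refine Finset.card_biUnion_le.trans ?_
    refine (Finset.sum_le_card_nsmul _ _ ((3 ^ d * d) ^ m) ?_).trans ?_
    · intro e' _
      exact Finset.card_image_le.trans (ih e')
    · rw [card_nbrs, smul_eq_mul, pow_succ, mul_comm]

lemma mem_chains (m : ℕ) (e : Edge d) (l : List (Edge d)) (hl : l.length = m)
    (hc : List.IsChain near (e :: l)) : (e :: l) ∈ chains m e := by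
  induction m generalizing e l with
  | zero =>
    rw [List.length_eq_zero_iff] at hl
    subst hl; simp [chains]
  | succ m ih =>
    cases l with
    | nil => simp at hl
    | cons b l =>
      rw [List.isChain_cons_cons] at hc
      rw [chains, Finset.mem_biUnion]
      refine ⟨b, mem_nbrs hc.1, Finset.mem_image_of_mem _ (ih b l ?_ hc.2)⟩
      simpa using hl

lemma near_refl (a : Edge d) : near a a := by intro k; simp

lemma gconn_chain (P : Finset (Edge d)) (hP : GConn P) (e : Edge d) (he : e ∈ P) (k : ℕ)
    (hk : k + 1 ≤ P.card) : ∃ l : List (Edge d), l.length = 2 * k ∧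
      List.IsChain near (e :: l) ∧ (e :: l).toFinset ⊆ P ∧ (e :: l).toFinset.card = k + 1 := by
  induction k with
  | zero => exact ⟨[], by simp, by simp, by simpa using he, by simp⟩
  | succ k ih =>
    obtain ⟨l, h1, h2, h3, h4⟩ := ih (by omega)
    obtain ⟨a, ha, b, hb, hbP, hab⟩ := hP _ h3 ⟨e, by simp⟩ (by
      intro h; rw [h] at h4; omega)
    rw [List.mem_toFinset] at ha
    obtain ⟨s, t, hst⟩ := List.append_of_mem ha
    have hch : List.IsChain near (s ++ a :: b :: a :: t) := by
      rw [hst, List.isChain_split] at h2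
      rw [List.isChain_split]
      refine ⟨h2.1, ?_⟩
      rw [List.isChain_cons_cons, List.isChain_cons_cons]
      exact ⟨hab, near_symm hab, h2.2⟩
    have hfs : (s ++ a :: b :: a :: t).toFinset = insert b (e :: l).toFinset := by
      rw [hst]; ext z
      simp only [List.mem_toFinset, List.mem_append, List.mem_cons, Finset.mem_insert]
      tauto
    have hlen : (s ++ a :: b :: a :: t).length = 2 * (k + 1) + 1 := by
      have := congrArg List.length hst
      simp at this ⊢; omega
    obtain ⟨l', hl'⟩ : ∃ l', s ++ a :: b :: a :: t = e :: l' := by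
      cases s with
      | nil =>
        simp only [List.nil_append, List.cons.injEq] at hst ⊢
        exact ⟨_, hst.1.symm, rfl⟩
      | cons c s =>
        simp only [List.cons_append, List.cons.injEq] at hst ⊢
        exact ⟨_, hst.1.symm, rfl⟩
    rw [hl'] at hch hfs hlen
    refine ⟨l', by simpa using hlen, hch, ?_, ?_⟩
    · rw [hfs]; exact Finset.insert_subset hb h3
    · rw [hfs, Finset.card_insert_of_notMem hbP, h4]

lemma card_gconn (S : Finset (Finset (Edge d))) (e : Edge d) (n : ℕ)
    (hS : ∀ P ∈ S, GConn P ∧ e ∈ P ∧ P.card = n + 1) : S.card ≤ (3 ^ d * d) ^ (2 * n) := by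
  refine le_trans ?_ (card_chains (2 * n) e)
  refine le_trans (Finset.card_le_card (t := (chains (2 * n) e).image List.toFinset) ?_)
    Finset.card_image_le
  intro P hPS
  obtain ⟨hg, he, hc⟩ := hS P hPS
  obtain ⟨l, h1, h2, h3, h4⟩ := gconn_chain P hg e he n (by omega)
  rw [Finset.mem_image]
  exact ⟨e :: l, mem_chains _ _ _ h1 h2, Finset.eq_of_subset_of_card_le h3 (by omega)⟩

/-- The sum over contours is small. -/
lemma contour_sum (i0 : Fin d) (x : V d) (S : Finset (Finset (Edge d)))
    (hS : ∀ P ∈ S, GConn P ∧ ∃ k : ℕ, k < P.card ∧ (x + k • ev i0, i0) ∈ P)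
    (q : ℝ) (hq : 0 ≤ q) (hq1 : 2 * ((3 ^ d * d : ℕ) : ℝ) ^ 2 * q ≤ 1 / 8) (hd : 1 ≤ d) :
    ∑ P ∈ S, q ^ P.card ≤ 1 / 4 := by
  classical
  set D : ℕ := 3 ^ d * d with hD
  have hD1 : 1 ≤ D := Nat.one_le_iff_ne_zero.2 (by positivity)
  -- group by size
  have hcard : ∀ n : ℕ, (S.filter (fun P => P.card = n + 1)).card ≤ (n + 1) * D ^ (2 * n) := by
    intro n
    have hsub : S.filter (fun P => P.card = n + 1) ⊆ (Finset.range (n + 1)).biUnion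
        (fun k => S.filter (fun P => P.card = n + 1 ∧ (x + k • ev i0, i0) ∈ P)) := by
      intro P hP
      rw [Finset.mem_filter] at hP
      obtain ⟨_, k, hk, hkP⟩ := hS P hP.1
      simp only [Finset.mem_biUnion, Finset.mem_range, Finset.mem_filter]
      exact ⟨k, by omega, hP.1, hP.2, hkP⟩
    refine (Finset.card_le_card hsub).trans (Finset.card_biUnion_le.trans ?_)
    refine (Finset.sum_le_card_nsmul _ _ (D ^ (2 * n)) ?_).trans ?_
    · intro k _
      apply card_gconn _ (x + k • ev i0, i0)
      intro P hP
      rw [Finset.mem_filter] at hP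
      exact ⟨(hS P hP.1).1, hP.2.2, hP.2.1⟩
    · simp
  set M := S.sup Finset.card with hM
  have hmaps : ∀ P ∈ S, P.card - 1 ∈ Finset.range (M + 1) := by
    intro P hP
    have : P.card ≤ M := Finset.le_sup (f := Finset.card) hP
    rw [Finset.mem_range]; omega
  rw [← Finset.sum_fiberwise_of_maps_to hmaps]
  have hn : ∀ n : ℕ, ∑ P ∈ S with P.card - 1 = n, q ^ P.card ≤ (1 / 8 : ℝ) * (1 / 8) ^ n := by
    intro n
    have hfe : S.filter (fun P => P.card - 1 = n) = S.filter (fun P => P.card = n + 1) := by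
      apply Finset.filter_congr
      intro P hP
      obtain ⟨_, k, hk, _⟩ := hS P hP
      omega
    rw [hfe]
    have h1 : ∑ P ∈ S with P.card = n + 1, q ^ P.card =
        (S.filter (fun P => P.card = n + 1)).card * q ^ (n + 1) := by
      rw [← nsmul_eq_mul, ← Finset.sum_const]
      apply Finset.sum_congr rfl
      intro P hP; rw [(Finset.mem_filter.1 hP).2]
    rw [h1]
    have h2 : ((S.filter (fun P => P.card = n + 1)).card : ℝ) ≤ (2 * (D : ℝ) ^ 2) ^ (n + 1) := by
      have h3 : ((S.filter (fun P => P.card = n + 1)).card : ℝ) ≤ ((n + 1 : ℕ) : ℝ) * (D : ℝ) ^ (2 * n) := by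
        exact_mod_cast hcard n
      refine h3.trans ?_
      rw [mul_pow, ← pow_mul]
      apply mul_le_mul
      · exact_mod_cast (Nat.lt_two_pow_self (n := n + 1)).le
      · apply pow_le_pow_right₀
        · exact_mod_cast hD1
        · omega
      · positivity
      · positivity
    calc ((S.filter (fun P => P.card = n + 1)).card : ℝ) * q ^ (n + 1)
        ≤ (2 * (D : ℝ) ^ 2) ^ (n + 1) * q ^ (n + 1) := by gcongr
      _ = (2 * (D : ℝ) ^ 2 * q) ^ (n + 1) := (mul_pow _ _ _).symm
      _ ≤ (1 / 8) ^ (n + 1) := by gcongr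
      _ = _ := by rw [pow_succ, mul_comm]
  refine (Finset.sum_le_sum fun n _ => hn n).trans ?_
  rw [← Finset.mul_sum]
  have hg : ∑ n ∈ Finset.range (M + 1), (1 / 8 : ℝ) ^ n ≤ 8 / 7 := by
    have h := Summable.sum_le_tsum (Finset.range (M + 1)) (fun n _ => by positivity)
      (summable_geometric_of_lt_one (r := (1 / 8 : ℝ)) (by norm_num) (by norm_num))
    rw [tsum_geometric_of_lt_one (by norm_num) (by norm_num)] at h
    refine h.trans (by norm_num)
  linarith

/-! ### Part C: mass transport -/

open scoped ENNReal

/-- `y` lies in the bounding box of `Δ`. -/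
def InBox (y : V d) (Δ : Finset (V d)) : Prop :=
  Δ.Nonempty ∧ ∀ i, (∃ a ∈ Δ, a i ≤ y i) ∧ ∃ b ∈ Δ, y i ≤ b i

lemma inBox_of_mem {y : V d} {Δ : Finset (V d)} (h : y ∈ Δ) : InBox y Δ :=
  ⟨⟨y, h⟩, fun _ => ⟨⟨y, h, le_rfl⟩, ⟨y, h, le_rfl⟩⟩⟩

lemma le_diam {Δ : Finset (V d)} {a b : V d} (ha : a ∈ Δ) (hb : b ∈ Δ) (i : Fin d) :
    (a i - b i).natAbs ≤ diam Δ := by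
  have h1 : (a i - b i).natAbs ≤ distInf a b :=
    Finset.le_sup (f := fun i => (a i - b i).natAbs) (Finset.mem_univ i)
  have h2 : distInf a b ≤ Δ.sup fun y => distInf a y :=
    Finset.le_sup (f := fun y => distInf a y) hb
  have h3 : (Δ.sup fun y => distInf a y) ≤ diam Δ :=
    Finset.le_sup (f := fun x => Δ.sup fun y => distInf x y) ha
  omega

open scoped Classical in
lemma box_count (Δ : Finset (V d)) :
    ∑' z : V d, (if InBox z Δ then (1 : ℝ≥0∞) else 0) ≤ ((diam Δ + 1 : ℕ) : ℝ≥0∞) ^ d := by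
  by_cases hne : Δ.Nonempty
  swap
  · have : ∀ z, ¬ InBox z Δ := fun z h => hne h.1
    simp [this]
  have hlo : ∀ i : Fin d, ∃ a ∈ Δ, ∀ b ∈ Δ, a i ≤ b i := fun i =>
    Finset.exists_min_image Δ (fun x => x i) hne
  have hhi : ∀ i : Fin d, ∃ a ∈ Δ, ∀ b ∈ Δ, b i ≤ a i := fun i =>
    Finset.exists_max_image Δ (fun x => x i) hne
  choose lo hlo1 hlo2 using hlo
  choose hi hhi1 hhi2 using hhi
  set R : Finset (V d) := Finset.Icc (fun i => lo i i) (fun i => hi i i) with hR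
  have hsub : ∀ z, InBox z Δ → z ∈ R := by
    intro z hz
    rw [hR, Finset.mem_Icc]
    refine ⟨fun i => ?_, fun i => ?_⟩
    · obtain ⟨a, ha, h⟩ := (hz.2 i).1
      exact (hlo2 i a ha).trans h
    · obtain ⟨a, ha, h⟩ := (hz.2 i).2
      exact h.trans (hhi2 i a ha)
  have hcard : R.card ≤ (diam Δ + 1) ^ d := by
    rw [hR, Pi.card_Icc]
    refine (Finset.prod_le_pow_card _ _ (diam Δ + 1) ?_).trans (by simp)
    intro i _
    rw [Int.card_Icc]
    have := le_diam (hhi1 i) (hlo1 i) i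
    omega
  calc ∑' z : V d, (if InBox z Δ then (1 : ℝ≥0∞) else 0)
      ≤ ∑' z : V d, (if z ∈ R then (1 : ℝ≥0∞) else 0) := by
        apply ENNReal.tsum_le_tsum
        intro z
        by_cases h : InBox z Δ
        · simp [h, hsub z h]
        · simp [h]
    _ = (R.card : ℝ≥0∞) := by
        rw [tsum_eq_sum (s := R)]
        · simp
        · intro z hz; simp [hz]
    _ ≤ ((diam Δ + 1 : ℕ) : ℝ≥0∞) ^ d := by exact_mod_cast hcard

lemma inBox_image (y x : V d) (Δ : Finset (V d)) :
    InBox y (Δ.image (fun z => z - (-x))) ↔ InBox (y - x) Δ := by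
  unfold InBox
  simp only [Finset.image_nonempty, Finset.exists_mem_image, Pi.sub_apply, Pi.neg_apply]
  refine and_congr_right fun _ => forall_congr' fun i => and_congr ?_ ?_
  · refine exists_congr fun a => and_congr_right fun _ => ?_
    constructor <;> intro h <;> linarith
  · refine exists_congr fun a => and_congr_right fun _ => ?_
    constructor <;> intro h <;> linarith

lemma sub_inj (a : V d) : Function.Injective (fun z : V d => z - a) := sub_left_injective

/-- Translation of finite sets as an equivalence. -/
def shiftEquiv (a : V d) : Finset (V d) ≃ Finset (V d) where
  toFun Δ := Δ.image (fun z => z - a)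
  invFun Δ := Δ.image (fun z => z - (-a))
  left_inv Δ := by simp only [Finset.image_image]; simp [Function.comp_def]
  right_inv Δ := by simp only [Finset.image_image]; simp [Function.comp_def]

open scoped Classical in
lemma mass_transport (s : Finset (V d) → ℝ≥0∞)
    (hs : ∀ a Δ, s (Δ.image (fun z => z - a)) = s Δ) (y : V d) :
    ∑' Δ : Finset (V d), (if InBox y Δ then s Δ else 0) ≤
      ∑' Δ : Finset (V d), (if (0 : V d) ∈ Δ then
        (Δ.card : ℝ≥0∞)⁻¹ * ((diam Δ + 1 : ℕ) : ℝ≥0∞) ^ d * s Δ else 0) := by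
  have step1 : ∀ Δ : Finset (V d), (if InBox y Δ then s Δ else 0) =
      ∑' x : V d, (if x ∈ Δ then (Δ.card : ℝ≥0∞)⁻¹ * (if InBox y Δ then s Δ else 0) else 0) := by
    intro Δ
    rw [tsum_eq_sum (s := Δ) (by intro z hz; simp [hz])]
    rw [Finset.sum_congr rfl (fun x hx => if_pos hx), Finset.sum_const, nsmul_eq_mul, ← mul_assoc]
    by_cases h : InBox y Δ
    · have hc : (Δ.card : ℝ≥0∞) ≠ 0 := by
        have := h.1.card_pos
        exact_mod_cast this.ne'
      rw [ENNReal.mul_inv_cancel hc (ENNReal.natCast_ne_top _), one_mul]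
    · simp [h]
  calc ∑' Δ : Finset (V d), (if InBox y Δ then s Δ else 0)
      = ∑' Δ : Finset (V d), ∑' x : V d,
          (if x ∈ Δ then (Δ.card : ℝ≥0∞)⁻¹ * (if InBox y Δ then s Δ else 0) else 0) :=
        tsum_congr step1
    _ = ∑' x : V d, ∑' Δ : Finset (V d),
          (if x ∈ Δ then (Δ.card : ℝ≥0∞)⁻¹ * (if InBox y Δ then s Δ else 0) else 0) :=
        ENNReal.tsum_comm
    _ = ∑' x : V d, ∑' Δ : Finset (V d),
          (if (0 : V d) ∈ Δ then (Δ.card : ℝ≥0∞)⁻¹ * (if InBox (y - x) Δ then s Δ else 0)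
            else 0) := by
        refine tsum_congr fun x => ?_
        rw [← (shiftEquiv (-x)).tsum_eq]
        refine tsum_congr fun Δ => ?_
        have h1 : x ∈ shiftEquiv (-x) Δ ↔ (0 : V d) ∈ Δ := by
          simp [shiftEquiv]
        have h2 : (shiftEquiv (-x) Δ).card = Δ.card :=
          Finset.card_image_of_injective _ (sub_inj _)
        have h3 : InBox y (shiftEquiv (-x) Δ) ↔ InBox (y - x) Δ := inBox_image y x Δ
        have h4 : s (shiftEquiv (-x) Δ) = s Δ := hs (-x) Δ
        simp only [h1, h2, h3, h4]
    _ = ∑' Δ : Finset (V d), ∑' x : V d,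
          (if (0 : V d) ∈ Δ then (Δ.card : ℝ≥0∞)⁻¹ * (if InBox (y - x) Δ then s Δ else 0)
            else 0) := ENNReal.tsum_comm
    _ ≤ _ := by
        apply ENNReal.tsum_le_tsum
        intro Δ
        by_cases h0 : (0 : V d) ∈ Δ
        · simp only [h0, if_true]
          rw [ENNReal.tsum_mul_left, mul_assoc]
          gcongr
          calc ∑' x : V d, (if InBox (y - x) Δ then s Δ else 0)
              = ∑' x : V d, (if InBox (y - x) Δ then 1 else 0) * s Δ := by
                refine tsum_congr fun x => ?_
                split_ifs <;> simp
            _ = (∑' x : V d, (if InBox (y - x) Δ then 1 else 0)) * s Δ := ENNReal.tsum_mul_right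
            _ = (∑' z : V d, (if InBox z Δ then 1 else 0)) * s Δ := by
                congr 1
                exact (Equiv.subLeft y).tsum_eq (fun z => if InBox z Δ then (1 : ℝ≥0∞) else 0)
            _ ≤ _ := by
                gcongr
                exact box_count Δ
        · simp [h0]

lemma real_of_ennreal {ι : Type*} (f : ι → ℝ) (hf : ∀ i, 0 ≤ f i) (c : ℝ) (hc : 0 ≤ c)
    (h : ∑' i, ENNReal.ofReal (f i) ≤ ENNReal.ofReal c) : Summable f ∧ ∑' i, f i ≤ c := by
  have key : ∀ u : Finset ι, ∑ i ∈ u, f i ≤ c := by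
    intro u
    have h1 := (ENNReal.sum_le_tsum (f := fun i => ENNReal.ofReal (f i)) u).trans h
    rw [← ENNReal.ofReal_sum_of_nonneg (fun i _ => hf i)] at h1
    exact (ENNReal.ofReal_le_ofReal_iff hc).1 h1
  exact ⟨summable_of_sum_le hf key, Real.tsum_le_of_sum_le hf key⟩

lemma isLocal_continuous {Ψ : Interaction d} (h : IsLocal Ψ) (Λ : Finset (V d)) :
    Continuous (Ψ Λ) := by
  have : Ψ Λ = (fun f : ↥Λ → Bool => Ψ Λ (fill Λ f plusC)) ∘ (fun ω (x : ↥Λ) => ω x.1) := by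
    funext ω
    apply h
    intro x hx
    simp [fill, hx]
  rw [this]
  exact continuous_of_discreteTopology.comp (by fun_prop)

lemma abs_le_supNorm {Ψ : Interaction d} (h : IsLocal Ψ) (Λ : Finset (V d)) (ω : Config d) :
    |Ψ Λ ω| ≤ supNorm Ψ Λ := by
  have hb : BddAbove (Set.range fun ω : Config d => |Ψ Λ ω|) :=
    (isCompact_range (isLocal_continuous h Λ).abs).bddAbove
  exact le_ciSup hb ω

lemma supNorm_nonneg (Ψ : Interaction d) (Λ : Finset (V d)) : 0 ≤ supNorm Ψ Λ :=
  Real.iSup_nonneg fun _ => abs_nonneg _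

lemma translate_surj (a : V d) : Function.Surjective (translate a) := by
  intro ω
  refine ⟨translate (-a) ω, ?_⟩
  funext x; simp [translate]

lemma supNorm_shift {Ψ : Interaction d} (h : TransInv Ψ) (a : V d) (Λ : Finset (V d)) :
    supNorm Ψ (Λ.image (fun x => x - a)) = supNorm Ψ Λ := by
  unfold supNorm
  symm
  refine (translate_surj a).iSup_congr _ (fun ω => ?_)
  rw [h a Λ ω]

lemma dnorm'_nonneg (Ψ : Interaction d) : 0 ≤ dnorm' Ψ := by
  apply tsum_nonneg
  intro Λ
  unfold dTerm'
  split_ifs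
  · have := supNorm_nonneg Ψ Λ
    positivity
  · exact le_rfl

open scoped Classical in
/-- The key estimate. -/
lemma sum_le_dnorm' {Ψ : Interaction d} (hT : TransInv Ψ) (hD : DSummable' Ψ)
    {ι : Type*} (T : Finset ι) (g : ι → V d) (Q : Finset (V d) → Prop)
    (hQ : ∀ Δ, Q Δ → ∃ t ∈ T, InBox (g t) Δ) :
    Summable (fun Δ => if Q Δ then supNorm Ψ Δ else 0) ∧
      ∑' Δ, (if Q Δ then supNorm Ψ Δ else 0) ≤ T.card * dnorm' Ψ := by
  apply real_of_ennreal
  · intro Δ; split_ifs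
    · exact supNorm_nonneg Ψ Δ
    · exact le_rfl
  · exact mul_nonneg (Nat.cast_nonneg _) (dnorm'_nonneg Ψ)
  set s : Finset (V d) → ℝ≥0∞ := fun Δ => ENNReal.ofReal (supNorm Ψ Δ) with hs
  have hterm : ∀ Δ : Finset (V d), (if (0 : V d) ∈ Δ then
        (Δ.card : ℝ≥0∞)⁻¹ * ((diam Δ + 1 : ℕ) : ℝ≥0∞) ^ d * s Δ else 0) =
      ENNReal.ofReal (dTerm' Ψ Δ) := by
    intro Δ
    unfold dTerm'
    by_cases h0 : (0 : V d) ∈ Δ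
    · simp only [h0, if_true]
      have hc : (0 : ℝ) < Δ.card := by exact_mod_cast Finset.card_pos.2 ⟨0, h0⟩
      rw [ENNReal.ofReal_mul (by positivity), ENNReal.ofReal_mul (by positivity),
        ENNReal.ofReal_inv_of_pos hc, ENNReal.ofReal_natCast, ENNReal.ofReal_pow (by positivity),
        ENNReal.ofReal_natCast]
    · simp [h0]
  have hnn : ∀ Δ, 0 ≤ dTerm' Ψ Δ := by
    intro Λ
    unfold dTerm'
    split_ifs
    · have := supNorm_nonneg Ψ Λ
      positivity
    · exact le_rfl
  calc ∑' Δ, ENNReal.ofReal (if Q Δ then supNorm Ψ Δ else 0)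
      ≤ ∑' Δ, ∑ t ∈ T, (if InBox (g t) Δ then s Δ else 0) := by
        apply ENNReal.tsum_le_tsum
        intro Δ
        by_cases h : Q Δ
        · obtain ⟨t, ht, hb⟩ := hQ Δ h
          rw [if_pos h]
          calc ENNReal.ofReal (supNorm Ψ Δ) = (if InBox (g t) Δ then s Δ else 0) := by simp [hb, hs]
            _ ≤ _ := Finset.single_le_sum (f := fun t => if InBox (g t) Δ then s Δ else 0)
                (fun _ _ => zero_le) ht
        · simp [h]
    _ = ∑ t ∈ T, ∑' Δ, (if InBox (g t) Δ then s Δ else 0) :=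
        Summable.tsum_finsetSum (fun _ _ => ENNReal.summable)
    _ ≤ ∑ t ∈ T, ENNReal.ofReal (dnorm' Ψ) := by
        apply Finset.sum_le_sum
        intro t _
        refine (mass_transport s ?_ (g t)).trans ?_
        · intro a Δ; simp only [hs]; rw [supNorm_shift hT]
        · rw [tsum_congr hterm, dnorm', ENNReal.ofReal_tsum_of_nonneg hnn hD]
    _ = _ := by
        rw [Finset.sum_const, nsmul_eq_mul, ENNReal.ofReal_mul (Nat.cast_nonneg _),
          ENNReal.ofReal_natCast]

/-! ### Part D: energy estimates -/

lemma cross_edge (A : Finset (V d)) (P : Finset (Edge d))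
    (hP : ∀ e : Edge d, e ∈ P ↔ ¬ (e.1 ∈ A ↔ e.1 + ev e.2 ∈ A)) (b : V d) (hb : b ∉ A) :
    ∀ n : ℕ, ∀ a : V d, a ∈ A → dist1 a b ≤ n →
      ∃ e ∈ P, ∀ i, min (a i) (b i) ≤ e.1 i ∧ e.1 i ≤ max (a i) (b i) := by
  intro n
  induction n with
  | zero =>
    intro a ha h
    exfalso
    have h0 : ∀ i, (a i - b i).natAbs = 0 := by
      intro i
      exact (Finset.sum_eq_zero_iff.1 (Nat.le_zero.1 h)) i (Finset.mem_univ i)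
    have : a = b := by
      funext i; have := h0 i; omega
    exact hb (this ▸ ha)
  | succ n ih =>
    intro a ha h
    have hne : a ≠ b := by rintro rfl; exact hb ha
    obtain ⟨i, hi⟩ := Function.ne_iff.1 hne
    have hlt : ∀ a' : V d, (∀ j, j ≠ i → a' j = a j) →
        (a' i - b i).natAbs < (a i - b i).natAbs → dist1 a' b ≤ n := by
      intro a' h1 h2
      have : dist1 a' b < dist1 a b := by
        apply Finset.sum_lt_sum
        · intro j _
          by_cases hj : j = i
          · subst hj; exact h2.le
          · rw [h1 j hj]
        · exact ⟨i, Finset.mem_univ i, h2⟩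
      omega
    have hfin : ∀ a' : V d, (∀ j, j ≠ i → a' j = a j) → (min (a i) (b i) ≤ a' i ∧ a' i ≤ max (a i) (b i)) →
        ∀ j, min (a j) (b j) ≤ a' j ∧ a' j ≤ max (a j) (b j) := by
      intro a' h1 h2 j
      by_cases hj : j = i
      · subst hj; exact h2
      · rw [h1 j hj]; exact ⟨min_le_left _ _, le_max_left _ _⟩
    have hrec : ∀ a' : V d, a' ∈ A → (∀ j, j ≠ i → a' j = a j) →
        (min (a i) (b i) ≤ a' i ∧ a' i ≤ max (a i) (b i)) →
        (a' i - b i).natAbs < (a i - b i).natAbs →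
        ∃ e ∈ P, ∀ i, min (a i) (b i) ≤ e.1 i ∧ e.1 i ≤ max (a i) (b i) := by
      intro a' ha' h1 h2 h3
      obtain ⟨e, he, h4⟩ := ih a' ha' (hlt a' h1 h3)
      refine ⟨e, he, fun j => ?_⟩
      have h5 := hfin a' h1 h2 j
      have h6 := h4 j
      omega
    rcases lt_or_gt_of_ne hi with hlt' | hgt
    · have e1 : (a + ev i) i = a i + 1 := by simp [ev_same]
      have e2 : ∀ j, j ≠ i → (a + ev i) j = a j := by intro j hj; simp [ev_ne hj]
      by_cases hm : a + ev i ∈ A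
      · exact hrec _ hm e2 (by omega) (by omega)
      · refine ⟨(a, i), (hP _).2 ?_, fun j => ⟨min_le_left _ _, le_max_left _ _⟩⟩
        simp [ha, hm]
    · have e1 : (a - ev i) i = a i - 1 := by simp [ev_same]
      have e2 : ∀ j, j ≠ i → (a - ev i) j = a j := by intro j hj; simp [ev_ne hj]
      by_cases hm : a - ev i ∈ A
      · exact hrec _ hm e2 (by omega) (by omega)
      · refine ⟨(a - ev i, i), (hP _).2 ?_, hfin (a - ev i) e2 (by omega)⟩
        simp [ha, hm]

/-- `Δ` meets both `A` and its complement -/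
def Crosses (A Δ : Finset (V d)) : Prop := (∃ a ∈ Δ, a ∈ A) ∧ ∃ b ∈ Δ, b ∉ A

lemma cross_inBox (A : Finset (V d)) (P : Finset (Edge d))
    (hP : ∀ e : Edge d, e ∈ P ↔ ¬ (e.1 ∈ A ↔ e.1 + ev e.2 ∈ A)) (Δ : Finset (V d))
    (h : Crosses A Δ) : ∃ e ∈ P, InBox e.1 Δ := by
  obtain ⟨⟨a, ha, haA⟩, b, hb, hbA⟩ := h
  obtain ⟨e, he, h⟩ := cross_edge A P hP b hbA (dist1 a b) a haA le_rfl
  refine ⟨e, he, ⟨a, ha⟩, fun i => ⟨?_, ?_⟩⟩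
  · rcases min_le_iff.1 (h i).1 with h1 | h1
    · exact ⟨a, ha, h1⟩
    · exact ⟨b, hb, h1⟩
  · rcases le_max_iff.1 (h i).2 with h1 | h1
    · exact ⟨a, ha, h1⟩
    · exact ⟨b, hb, h1⟩

/-- nearest neighbour pair -/
def NN (Δ : Finset (V d)) : Prop :=
  Δ.card = 2 ∧ ∀ x ∈ Δ, ∀ y ∈ Δ, x ≠ y → dist1 x y = 1

/-- the pair of endpoints of an edge -/
def pr (e : Edge d) : Finset (V d) := {e.1, e.1 + ev e.2}

lemma ne_add_ev (y : V d) (i : Fin d) : y ≠ y + ev i := by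
  intro h
  have := congrFun h i
  simp [ev_same] at this

lemma dist1_comm (x y : V d) : dist1 x y = dist1 y x := by
  unfold dist1
  apply Finset.sum_congr rfl
  intro i _; omega

lemma dist1_ev (y : V d) (i : Fin d) : dist1 y (y + ev i) = 1 := by
  unfold dist1
  rw [Finset.sum_eq_single i]
  · simp [ev_same]
  · intro j _ hj; simp [ev_ne hj]
  · simp

lemma nn_pr (e : Edge d) : NN (pr e) := by
  refine ⟨Finset.card_pair (ne_add_ev _ _), ?_⟩
  intro x hx y hy hxy
  simp only [pr, Finset.mem_insert, Finset.mem_singleton] at hx hy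
  rcases hx with rfl | rfl <;> rcases hy with rfl | rfl
  · exact absurd rfl hxy
  · exact dist1_ev _ _
  · rw [dist1_comm]; exact dist1_ev _ _
  · exact absurd rfl hxy

lemma dist1_one (x y : V d) (h : dist1 x y = 1) : (∃ i, y = x + ev i) ∨ ∃ i, x = y + ev i := by
  have hne : ∃ i, (x i - y i).natAbs ≠ 0 := by
    by_contra hc
    push Not at hc
    have : dist1 x y = 0 := Finset.sum_eq_zero fun i _ => hc i
    omega
  obtain ⟨i, hi⟩ := hne
  have hsum : (x i - y i).natAbs + ∑ j ∈ Finset.univ.erase i, (x j - y j).natAbs = 1 := by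
    rw [Finset.add_sum_erase _ (fun j => (x j - y j).natAbs) (Finset.mem_univ i)]; exact h
  have hz : ∀ j, j ≠ i → x j = y j := by
    intro j hj
    have h1 : (x j - y j).natAbs ≤ ∑ j ∈ Finset.univ.erase i, (x j - y j).natAbs :=
      Finset.single_le_sum (f := fun j => (x j - y j).natAbs) (fun _ _ => Nat.zero_le _)
        (Finset.mem_erase.2 ⟨hj, Finset.mem_univ j⟩)
    omega
  have hi1 : (x i - y i).natAbs = 1 := by omega
  rcases Int.natAbs_eq (x i - y i) with h1 | h1
  · right; refine ⟨i, ?_⟩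
    funext j
    by_cases hj : j = i
    · subst hj; simp only [Pi.add_apply, ev_same]; omega
    · simp [ev_ne hj, hz j hj]
  · left; refine ⟨i, ?_⟩
    funext j
    by_cases hj : j = i
    · subst hj; simp only [Pi.add_apply, ev_same]; omega
    · simp [ev_ne hj, hz j hj]

lemma nn_exists {Δ : Finset (V d)} (h : NN Δ) : ∃ e : Edge d, Δ = pr e := by
  obtain ⟨x, y, hxy, rfl⟩ := Finset.card_eq_two.1 h.1
  have h1 := h.2 x (by simp) y (by simp) hxy
  rcases dist1_one x y h1 with ⟨i, rfl⟩ | ⟨i, rfl⟩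
  · exact ⟨(x, i), rfl⟩
  · exact ⟨(y, i), by simp [pr, Finset.pair_comm]⟩

lemma ev_inj {i j : Fin d} (h : ev i = ev j) : i = j := by
  by_contra hne
  have := congrFun h i
  rw [ev_same, ev_ne hne] at this
  omega

lemma pr_inj : Function.Injective (pr : Edge d → Finset (V d)) := by
  rintro ⟨y, i⟩ ⟨z, j⟩ h
  have h1 : y ∈ pr (z, j) := by rw [← h]; simp [pr]
  have h2 : y + ev i ∈ pr (z, j) := by rw [← h]; simp [pr]
  simp only [pr, Finset.mem_insert, Finset.mem_singleton] at h1 h2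
  rcases h1 with rfl | h1
  · rcases h2 with h2 | h2
    · exact absurd h2.symm (ne_add_ev _ _)
    · rw [ev_inj (add_left_cancel h2)]
  · exfalso
    rcases h2 with h2 | h2
    · have h3 := congrFun h1 i
      have h4 := congrFun h2 i
      simp only [Pi.add_apply, ev_same] at h3 h4
      rcases ev_mem01 j i with h | h <;> omega
    · rw [← h1] at h2
      exact ne_add_ev _ _ h2.symm

lemma ising_nn (β : ℝ) {Δ : Finset (V d)} (h : NN Δ) (ω : Config d) :
    ising β Δ ω = -β * ∏ x ∈ Δ, spin (ω x) := if_pos h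

lemma ising_not (β : ℝ) {Δ : Finset (V d)} (h : ¬ NN Δ) (ω : Config d) :
    ising β Δ ω = 0 := if_neg h

lemma ising_pr (β : ℝ) (e : Edge d) (ω : Config d) :
    ising β (pr e) ω = -β * (spin (ω e.1) * spin (ω (e.1 + ev e.2))) := by
  rw [ising_nn β (nn_pr e), pr, Finset.prod_pair (ne_add_ev _ _)]

lemma spin_not (b : Bool) : spin (!b) = - spin b := by cases b <;> simp [spin]

lemma ising_local (β : ℝ) : IsLocal (ising β : Interaction d) := by
  intro Λ ω ω' h
  unfold ising
  congr 2
  exact Finset.prod_congr rfl fun x hx => by rw [h x hx]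

lemma ising_flip (β : ℝ) : SpinFlipSymm (ising β : Interaction d) := by
  intro Λ ω
  by_cases h : NN Λ
  · obtain ⟨e, rfl⟩ := nn_exists h
    rw [ising_pr, ising_pr]; simp [spin_not]
  · rw [ising_not β h, ising_not β h]

lemma dist1_sub (x y a : V d) : dist1 (x - a) (y - a) = dist1 x y := by
  unfold dist1; simp

lemma nn_image (Λ : Finset (V d)) (a : V d) : NN (Λ.image (fun x => x - a)) ↔ NN Λ := by
  unfold NN
  rw [Finset.card_image_of_injective _ (sub_inj a)]
  simp [dist1_sub]

lemma ising_trans (β : ℝ) : TransInv (ising β : Interaction d) := by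
  intro a Λ ω
  by_cases h : NN Λ
  · rw [ising_nn β h, ising_nn β ((nn_image Λ a).2 h),
      Finset.prod_image (fun x _ y _ hxy => sub_inj a hxy)]
    simp [translate]
  · rw [ising_not β h, ising_not β (fun h' => h ((nn_image Λ a).1 h'))]

lemma ising_dsum (β : ℝ) : DSummable' (ising β : Interaction d) := by
  apply summable_of_ne_finset_zero (s := (Finset.Icc (-1 : V d) 1).powerset)
  intro Δ hΔ
  unfold dTerm'
  by_cases h0 : (0 : V d) ∈ Δ
  · rw [if_pos h0]
    have hn : ¬ NN Δ := by
      intro hN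
      apply hΔ
      rw [Finset.mem_powerset]
      intro y hy
      by_cases hy0 : 0 = y
      · subst hy0; simp [Pi.le_def]
      · have := hN.2 0 h0 y hy hy0
        rcases dist1_one _ _ this with ⟨i, h⟩ | ⟨i, h⟩
        · rw [Finset.mem_Icc, h]
          constructor <;> intro k <;> rcases ev_mem01 i k with h | h <;> simp [h]
        · have : y = - ev i := by rw [eq_neg_iff_add_eq_zero]; exact h.symm
          rw [Finset.mem_Icc, this]
          constructor <;> intro k <;> rcases ev_mem01 i k with h | h <;> simp [h]
    have : supNorm (ising β) Δ = 0 := by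
      unfold supNorm; simp [ising_not β hn]
    rw [this, mul_zero]
  · rw [if_neg h0]

/-- Bundle of the properties of the total interaction. -/
structure Good (Φ : Interaction d) : Prop where
  loc : IsLocal Φ
  tr : TransInv Φ
  fl : SpinFlipSymm Φ
  ds : DSummable' Φ

lemma supNorm_add_le {Φ Ψ : Interaction d} (h1 : IsLocal Φ) (h2 : IsLocal Ψ) (Λ : Finset (V d)) :
    supNorm (Iadd Φ Ψ) Λ ≤ supNorm Φ Λ + supNorm Ψ Λ := by
  have : Nonempty (Config d) := ⟨plusC⟩
  apply ciSup_le
  intro ω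
  exact (abs_add_le _ _).trans (add_le_add (abs_le_supNorm h1 Λ ω) (abs_le_supNorm h2 Λ ω))

lemma dTerm'_nonneg (Ψ : Interaction d) (Λ : Finset (V d)) : 0 ≤ dTerm' Ψ Λ := by
  unfold dTerm'
  split_ifs
  · have := supNorm_nonneg Ψ Λ
    positivity
  · exact le_rfl

lemma good_add (β : ℝ) {Ψ : Interaction d} (h1 : IsLocal Ψ) (h2 : TransInv Ψ)
    (h3 : SpinFlipSymm Ψ) (h4 : DSummable' Ψ) : Good (Iadd (ising β) Ψ) where
  loc := fun Λ ω ω' h => by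
    unfold Iadd; rw [ising_local β Λ ω ω' h, h1 Λ ω ω' h]
  tr := fun a Λ ω => by unfold Iadd; rw [ising_trans β a Λ ω, h2 a Λ ω]
  fl := fun Λ ω => by unfold Iadd; rw [ising_flip β Λ ω, h3 Λ ω]
  ds := by
    refine Summable.of_nonneg_of_le (dTerm'_nonneg _) (fun Λ => ?_) ((ising_dsum β).add h4)
    unfold dTerm'
    split_ifs
    · rw [← mul_add]
      apply mul_le_mul_of_nonneg_left (supNorm_add_le (ising_local β) h1 Λ)
      positivity
    · simp

open scoped Classical in
lemma ham_bound_summable {Φ : Interaction d} (hΦ : Good Φ) (Λ : Finset (V d)) :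
    Summable (fun Δ => if (Δ ∩ Λ).Nonempty then supNorm Φ Δ else 0) := by
  have := (sum_le_dnorm' hΦ.tr hΦ.ds Λ id (fun Δ => (Δ ∩ Λ).Nonempty) (by
    rintro Δ ⟨x, hx⟩
    rw [Finset.mem_inter] at hx
    exact ⟨x, hx.2, inBox_of_mem hx.1⟩)).1
  convert this

lemma ham_summable {Φ : Interaction d} (hΦ : Good Φ) (Λ : Finset (V d)) (ω : Config d) :
    Summable (fun Δ => if (Δ ∩ Λ).Nonempty then Φ Δ ω else 0) := by
  refine Summable.of_norm_bounded (ham_bound_summable hΦ Λ) (fun Δ => ?_)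
  split_ifs
  · exact abs_le_supNorm hΦ.loc Δ ω
  · simp

lemma ham_continuous {Φ : Interaction d} (hΦ : Good Φ) (Λ : Finset (V d)) :
    Continuous (ham Φ Λ) := by
  refine continuous_tsum (fun Δ => ?_) (ham_bound_summable hΦ Λ) (fun Δ ω => ?_)
  · split_ifs
    · exact isLocal_continuous hΦ.loc Δ
    · exact continuous_const
  · split_ifs
    · exact abs_le_supNorm hΦ.loc Δ ω
    · simp

lemma flip_eq {Φ : Interaction d} (h1 : IsLocal Φ) (h2 : SpinFlipSymm Φ) (A Δ : Finset (V d))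
    (ω : Config d) (h : ¬ Crosses A Δ) : Φ Δ (flipOn A ω) = Φ Δ ω := by
  by_cases hA : ∃ a ∈ Δ, a ∈ A
  · rw [← h2 Δ ω]
    apply h1
    intro x hx
    have : x ∈ A := by
      by_contra hc
      exact h ⟨hA, x, hx, hc⟩
    simp [flipOn, this]
  · apply h1
    intro x hx
    have : x ∉ A := fun hc => hA ⟨x, hx, hc⟩
    simp [flipOn, this]

theorem energy_diff (β : ℝ) {Ψ : Interaction d} (h1 : IsLocal Ψ) (h2 : TransInv Ψ)
    (h3 : SpinFlipSymm Ψ) (h4 : DSummable' Ψ) (Λ A : Finset (V d)) (hA : A ⊆ Λ)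
    (P : Finset (Edge d)) (hP : ∀ e : Edge d, e ∈ P ↔ ¬ (e.1 ∈ A ↔ e.1 + ev e.2 ∈ A))
    (ω : Config d) (hdis : ∀ e ∈ P, dis ω e) :
    ham (Iadd (ising β) Ψ) Λ (flipOn A ω) ≤
      ham (Iadd (ising β) Ψ) Λ ω - 2 * (β - dnorm' Ψ) * P.card := by
  classical
  have hG := good_add β h1 h2 h3 h4
  have hs1 := ham_summable hG Λ (flipOn A ω)
  have hs2 := ham_summable hG Λ ω
  obtain ⟨hc1, hc2⟩ := sum_le_dnorm' h2 h4 P (fun e => e.1) (Crosses A) (cross_inBox A P hP)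
  have hi1 : Summable (fun Δ => if Δ ∈ P.image pr then -2 * β else 0) :=
    summable_of_ne_finset_zero (s := P.image pr) (fun Δ h => by simp [h])
  have hi2 : ∑' Δ, (if Δ ∈ P.image pr then -2 * β else 0) = -2 * β * P.card := by
    rw [tsum_eq_sum (s := P.image pr) (fun Δ h => by simp [h]),
      Finset.sum_congr rfl (fun Δ h => if_pos h), Finset.sum_const,
      Finset.card_image_of_injective _ pr_inj, nsmul_eq_mul, mul_comm]
  have hcr : ∀ e : Edge d, Crosses A (pr e) ↔ e ∈ P := by
    intro e
    rw [hP]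
    unfold Crosses
    simp only [pr, Finset.mem_insert, Finset.mem_singleton, exists_eq_or_imp, exists_eq_left]
    tauto
  have hpt : ∀ Δ, (if (Δ ∩ Λ).Nonempty then Iadd (ising β) Ψ Δ (flipOn A ω) else 0) -
      (if (Δ ∩ Λ).Nonempty then Iadd (ising β) Ψ Δ ω else 0) ≤
      (if Δ ∈ P.image pr then -2 * β else 0) + 2 * (if Crosses A Δ then supNorm Ψ Δ else 0) := by
    intro Δ
    by_cases hc : Crosses A Δ
    · have hm : (Δ ∩ Λ).Nonempty := by
        obtain ⟨⟨a, ha, haA⟩, _⟩ := hc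
        exact ⟨a, Finset.mem_inter.2 ⟨ha, hA haA⟩⟩
      rw [if_pos hm, if_pos hm, if_pos hc]
      have hΨ : Ψ Δ (flipOn A ω) - Ψ Δ ω ≤ 2 * supNorm Ψ Δ := by
        have := (abs_le.1 (abs_le_supNorm h1 Δ (flipOn A ω))).2
        have := (abs_le.1 (abs_le_supNorm h1 Δ ω)).1
        linarith
      have hI : ising β Δ (flipOn A ω) - ising β Δ ω ≤
          (if Δ ∈ P.image pr then -2 * β else 0) := by
        by_cases hN : NN Δ
        · obtain ⟨e, rfl⟩ := nn_exists hN
          have heP := (hcr e).1 hc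
          rw [if_pos (Finset.mem_image_of_mem _ heP), ising_pr, ising_pr]
          have hd := hdis e heP
          have hb := (hP e).1 heP
          unfold dis at hd
          have hs : spin (ω e.1) * spin (ω (e.1 + ev e.2)) = -1 := by
            revert hd
            cases ω e.1 <;> cases ω (e.1 + ev e.2) <;> simp [spin]
          have hs' : spin (flipOn A ω e.1) * spin (flipOn A ω (e.1 + ev e.2)) = 1 := by
            unfold flipOn
            by_cases hx : e.1 ∈ A
            · have hy : e.1 + ev e.2 ∉ A := by tauto
              rw [if_pos hx, if_neg hy, spin_not]; linarith
            · have hy : e.1 + ev e.2 ∈ A := by tauto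
              rw [if_neg hx, if_pos hy, spin_not]; linarith
          rw [hs, hs']; linarith
        · rw [ising_not β hN, ising_not β hN, if_neg]
          · simp
          · intro hmem
            obtain ⟨e, _, rfl⟩ := Finset.mem_image.1 hmem
            exact hN (nn_pr e)
      unfold Iadd
      linarith
    · have hn : Δ ∉ P.image pr := by
        intro hmem
        obtain ⟨e, he, rfl⟩ := Finset.mem_image.1 hmem
        exact hc ((hcr e).2 he)
      rw [flip_eq hG.loc hG.fl A Δ ω hc, if_neg hn, if_neg hc]
      simp
  have hfin := Summable.tsum_le_tsum hpt (hs1.sub hs2) (hi1.add (hc1.mul_left 2))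
  rw [hs1.tsum_sub hs2, hi1.tsum_add (hc1.mul_left 2), hi2, tsum_mul_left] at hfin
  unfold ham
  linarith

/-! ### Part E: the Peierls estimate -/

/-- local flip of a finite configuration -/
def flipF (Λ A : Finset (V d)) (f : ↥Λ → Bool) : ↥Λ → Bool :=
  fun y => if y.1 ∈ A then !(f y) else f y

lemma flipF_invol (Λ A : Finset (V d)) : Function.Involutive (flipF Λ A) := by
  intro f
  funext y
  unfold flipF
  split_ifs <;> simp

lemma flipOn_fill (Λ A : Finset (V d)) (hA : A ⊆ Λ) (f : ↥Λ → Bool) (η : Config d) :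
    flipOn A (fill Λ f η) = fill Λ (flipF Λ A f) η := by
  funext y
  unfold flipOn fill flipF
  by_cases hy : y ∈ Λ
  · simp [hy]
  · have : y ∉ A := fun h => hy (hA h)
    simp [hy, this]

lemma gibbsZ_pos (Φ : Interaction d) (Λ : Finset (V d)) (η : Config d) : 0 < gibbsZ Φ Λ η :=
  Finset.sum_pos (fun _ _ => Real.exp_pos _) Finset.univ_nonempty

theorem peierls (i0 i1 : Fin d) (h01 : i0 ≠ i1) (β : ℝ) {Ψ : Interaction d} (h1 : IsLocal Ψ)
    (h2 : TransInv Ψ) (h3 : SpinFlipSymm Ψ) (h4 : DSummable' Ψ)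
    (hq : 2 * ((3 ^ d * d : ℕ) : ℝ) ^ 2 * Real.exp (-(2 * (β - dnorm' Ψ))) ≤ 1 / 8)
    (l u x : V d) :
    ∑ f : ↥(Finset.Icc l u) → Bool, (if fill (Finset.Icc l u) f plusC x = false then
      finGibbs (Iadd (ising β) Ψ) (Finset.Icc l u) plusC f else 0) ≤ 1 / 4 := by
  classical
  set Λ := Finset.Icc l u with hΛ
  set Φ := Iadd (ising β) Ψ with hΦ
  set q := Real.exp (-(2 * (β - dnorm' Ψ))) with hqdef
  have hd : 1 ≤ d := by have := i0.2; omega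
  have hZ := gibbsZ_pos Φ Λ plusC
  have hex : ∀ f : ↥Λ → Bool, fill Λ f plusC x = false → ∃ P : Finset (Edge d), GConn P ∧
      (∀ e ∈ P, dis (fill Λ f plusC) e) ∧
      (∀ e : Edge d, e ∈ P ↔ ¬ (e.1 ∈ inside i0 Λ P ↔ e.1 + ev e.2 ∈ inside i0 Λ P)) ∧
      ∃ k : ℕ, k < P.card ∧ (x + k • ev i0, i0) ∈ P := by
    intro f hf
    refine contour_exists i0 i1 h01 l u _ ?_ x hf
    intro y hy
    unfold fill
    rw [dif_neg hy]; rfl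
  clear_value Λ
  choose! P hP using hex
  set bad := Finset.univ.filter (fun f : ↥Λ → Bool => fill Λ f plusC x = false) with hbad
  have key : ∀ p ∈ bad.image P, ∑ f ∈ bad with P f = p,
      Real.exp (-(ham Φ Λ (fill Λ f plusC))) ≤ q ^ p.card * gibbsZ Φ Λ plusC := by
    intro p _
    have hA : inside i0 Λ p ⊆ Λ := Finset.filter_subset _ _
    calc _ ≤ ∑ f ∈ bad with P f = p,
          q ^ p.card * Real.exp (-(ham Φ Λ (fill Λ (flipF Λ (inside i0 Λ p) f) plusC))) := by
          apply Finset.sum_le_sum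
          intro f hf
          rw [Finset.mem_filter, hbad, Finset.mem_filter] at hf
          obtain ⟨⟨_, hf1⟩, rfl⟩ := hf
          have hh := hP f hf1
          rw [← flipOn_fill Λ _ hA]
          have := energy_diff β h1 h2 h3 h4 Λ _ hA (P f) hh.2.2.1 _ hh.2.1
          rw [hqdef, ← Real.exp_nat_mul, ← Real.exp_add, Real.exp_le_exp]
          linarith
      _ ≤ ∑ f : ↥Λ → Bool,
          q ^ p.card * Real.exp (-(ham Φ Λ (fill Λ (flipF Λ (inside i0 Λ p) f) plusC))) := by
          apply Finset.sum_le_sum_of_subset_of_nonneg (Finset.subset_univ _)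
          intro _ _ _
          exact mul_nonneg (pow_nonneg (Real.exp_pos _).le _) (Real.exp_pos _).le
      _ = q ^ p.card * gibbsZ Φ Λ plusC := by
          rw [← Finset.mul_sum]
          congr 1
          exact Equiv.sum_comp (flipF_invol Λ (inside i0 Λ p)).toPerm
            (fun f => Real.exp (-(ham Φ Λ (fill Λ f plusC))))
  have hsum : ∑ p ∈ bad.image P, q ^ p.card ≤ 1 / 4 := by
    apply contour_sum i0 x _ _ q (Real.exp_pos _).le hq hd
    intro p hp
    obtain ⟨f, hf, rfl⟩ := Finset.mem_image.1 hp
    have hh := hP f (Finset.mem_filter.1 hf).2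
    exact ⟨hh.1, hh.2.2.2⟩
  rw [← Finset.sum_filter]
  change ∑ f ∈ bad, Real.exp (-(ham Φ Λ (fill Λ f plusC))) / gibbsZ Φ Λ plusC ≤ _
  rw [← Finset.sum_div, div_le_iff₀ hZ,
    ← Finset.sum_fiberwise_of_maps_to (fun f hf => Finset.mem_image_of_mem P hf)]
  calc _ ≤ ∑ p ∈ bad.image P, q ^ p.card * gibbsZ Φ Λ plusC := Finset.sum_le_sum key
    _ = (∑ p ∈ bad.image P, q ^ p.card) * gibbsZ Φ Λ plusC := (Finset.sum_mul _ _ _).symm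
    _ ≤ _ := mul_le_mul_of_nonneg_right hsum hZ.le

/-! ### Part F: Gibbs kernels -/

/-- the Gibbs kernel acting on functions -/
def gam (Φ : Interaction d) (Λ : Finset (V d)) (F : Config d → ℝ) (η : Config d) : ℝ :=
  ∑ f : ↥Λ → Bool, finGibbs Φ Λ η f * F (fill Λ f η)

lemma finGibbs_nonneg (Φ : Interaction d) (Λ : Finset (V d)) (η : Config d) (f : ↥Λ → Bool) :
    0 ≤ finGibbs Φ Λ η f := div_nonneg (Real.exp_pos _).le (gibbsZ_pos _ _ _).le

lemma finGibbs_sum (Φ : Interaction d) (Λ : Finset (V d)) (η : Config d) :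
    ∑ f : ↥Λ → Bool, finGibbs Φ Λ η f = 1 := by
  unfold finGibbs
  rw [← Finset.sum_div]
  exact div_self (gibbsZ_pos Φ Λ η).ne'

lemma fill_continuous (Λ : Finset (V d)) (f : ↥Λ → Bool) : Continuous (fill Λ f) := by
  apply continuous_pi
  intro x
  unfold fill
  by_cases h : x ∈ Λ
  · simp only [h, dite_true]; exact continuous_const
  · simp only [h, dite_false]; exact continuous_apply x

lemma finGibbs_continuous {Φ : Interaction d} (hΦ : Good Φ) (Λ : Finset (V d)) (f : ↥Λ → Bool) :
    Continuous (fun η => finGibbs Φ Λ η f) := by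
  have h : ∀ f : ↥Λ → Bool, Continuous (fun η => Real.exp (-(ham Φ Λ (fill Λ f η)))) := fun f =>
    Real.continuous_exp.comp ((ham_continuous hΦ Λ).comp (fill_continuous Λ f)).neg
  unfold finGibbs
  refine (h f).div ?_ (fun η => (gibbsZ_pos Φ Λ η).ne')
  unfold gibbsZ
  exact continuous_finset_sum _ (fun f _ => h f)

lemma gam_continuous {Φ : Interaction d} (hΦ : Good Φ) (Λ : Finset (V d)) {F : Config d → ℝ}
    (hF : Continuous F) : Continuous (gam Φ Λ F) := by
  unfold gam
  exact continuous_finset_sum _ (fun f _ =>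
    (finGibbs_continuous hΦ Λ f).mul (hF.comp (fill_continuous Λ f)))

lemma fill_fill (Λ : Finset (V d)) (f g : ↥Λ → Bool) (η : Config d) :
    fill Λ g (fill Λ f η) = fill Λ g η := by
  funext x; unfold fill; split_ifs <;> rfl

lemma gibbsZ_fill (Φ : Interaction d) (Λ : Finset (V d)) (f : ↥Λ → Bool) (η : Config d) :
    gibbsZ Φ Λ (fill Λ f η) = gibbsZ Φ Λ η := by
  unfold gibbsZ; simp only [fill_fill]

lemma ham_balance {Φ : Interaction d} (hΦ : Good Φ) {Λ Λ' : Finset (V d)} (h : Λ ⊆ Λ')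
    (f : ↥Λ → Bool) (ω : Config d) :
    ham Φ Λ' (fill Λ f ω) - ham Φ Λ (fill Λ f ω) = ham Φ Λ' ω - ham Φ Λ ω := by
  unfold ham
  rw [← (ham_summable hΦ Λ' _).tsum_sub (ham_summable hΦ Λ _),
    ← (ham_summable hΦ Λ' _).tsum_sub (ham_summable hΦ Λ _)]
  refine tsum_congr fun Δ => ?_
  by_cases h1 : (Δ ∩ Λ).Nonempty
  · have h2 : (Δ ∩ Λ').Nonempty := h1.mono (Finset.inter_subset_inter_left h)
    simp [h1, h2]
  · have : Φ Δ (fill Λ f ω) = Φ Δ ω := by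
      apply hΦ.loc
      intro x hx
      have : x ∉ Λ := fun hc => h1 ⟨x, Finset.mem_inter.2 ⟨hx, hc⟩⟩
      simp [fill, this]
    rw [this]

/-- the exchange of inner configurations -/
def swp {Λ Λ' : Finset (V d)} (h : Λ ⊆ Λ') (p : (↥Λ' → Bool) × (↥Λ → Bool)) :
    (↥Λ' → Bool) × (↥Λ → Bool) :=
  (fun y => if hy : y.1 ∈ Λ then p.2 ⟨y.1, hy⟩ else p.1 y, fun y => p.1 ⟨y.1, h y.2⟩)

lemma swp_invol {Λ Λ' : Finset (V d)} (h : Λ ⊆ Λ') : Function.Involutive (swp h) := by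
  rintro ⟨g, f⟩
  ext y
  · by_cases hy : y.1 ∈ Λ <;> simp [swp, hy]
  · simp [swp]

lemma swp_fill1 {Λ Λ' : Finset (V d)} (h : Λ ⊆ Λ') (p : (↥Λ' → Bool) × (↥Λ → Bool))
    (η : Config d) : fill Λ' (swp h p).1 η = fill Λ p.2 (fill Λ' p.1 η) := by
  funext x
  unfold fill swp
  by_cases hx : x ∈ Λ
  · simp [hx, h hx]
  · simp [hx]

lemma swp_fill2 {Λ Λ' : Finset (V d)} (h : Λ ⊆ Λ') (p : (↥Λ' → Bool) × (↥Λ → Bool))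
    (η : Config d) : fill Λ (swp h p).2 (fill Λ' (swp h p).1 η) = fill Λ' p.1 η := by
  have := swp_fill1 h (swp h p) η
  rw [swp_invol h p] at this
  exact this.symm

theorem gam_consistent {Φ : Interaction d} (hΦ : Good Φ) {Λ Λ' : Finset (V d)} (h : Λ ⊆ Λ')
    (F : Config d → ℝ) (η : Config d) : gam Φ Λ' (gam Φ Λ F) η = gam Φ Λ' F η := by
  have e1 : gam Φ Λ' (gam Φ Λ F) η = ∑ p : (↥Λ' → Bool) × (↥Λ → Bool),
      finGibbs Φ Λ' η p.1 * (finGibbs Φ Λ (fill Λ' p.1 η) p.2 *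
        F (fill Λ p.2 (fill Λ' p.1 η))) := by
    rw [Fintype.sum_prod_type]
    simp only [gam, Finset.mul_sum]
  have e2 : gam Φ Λ' F η = ∑ p : (↥Λ' → Bool) × (↥Λ → Bool),
      finGibbs Φ Λ' η p.1 * (finGibbs Φ Λ (fill Λ' p.1 η) p.2 * F (fill Λ' p.1 η)) := by
    rw [Fintype.sum_prod_type]
    simp only [gam, ← Finset.mul_sum, ← Finset.sum_mul, finGibbs_sum, one_mul]
  rw [e1, e2, ← Equiv.sum_comp (swp_invol h).toPerm]
  refine Finset.sum_congr rfl fun p _ => ?_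
  simp only [Function.Involutive.coe_toPerm]
  rw [swp_fill2]
  rw [← mul_assoc, ← mul_assoc]
  congr 1
  unfold finGibbs
  rw [swp_fill2, swp_fill1, gibbsZ_fill]
  have hb := ham_balance hΦ h p.2 (fill Λ' p.1 η)
  rw [div_mul_div_comm, div_mul_div_comm, ← Real.exp_add, ← Real.exp_add]
  congr 2
  linarith

lemma ham_translate {Φ : Interaction d} (hΦ : Good Φ) (Λ : Finset (V d)) (a : V d)
    (ω : Config d) : ham Φ Λ (translate a ω) = ham Φ (Λ.image (fun x => x + a)) ω := by
  unfold ham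
  rw [← (shiftEquiv a).tsum_eq]
  refine tsum_congr fun Δ => ?_
  have h1 : Φ (shiftEquiv a Δ) (translate a ω) = Φ Δ ω := hΦ.tr a Δ ω
  have h2 : (shiftEquiv a Δ ∩ Λ).Nonempty ↔ (Δ ∩ Λ.image (fun x => x + a)).Nonempty := by
    constructor
    · rintro ⟨x, hx⟩
      rw [Finset.mem_inter] at hx
      obtain ⟨y, hy, rfl⟩ := Finset.mem_image.1 hx.1
      exact ⟨y, Finset.mem_inter.2 ⟨hy, Finset.mem_image.2 ⟨_, hx.2, by simp⟩⟩⟩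
    · rintro ⟨x, hx⟩
      rw [Finset.mem_inter] at hx
      obtain ⟨y, hy, rfl⟩ := Finset.mem_image.1 hx.2
      exact ⟨y, Finset.mem_inter.2 ⟨Finset.mem_image.2 ⟨_, hx.1, by simp⟩, hy⟩⟩
  rw [h1]
  by_cases h : (shiftEquiv a Δ ∩ Λ).Nonempty
  · rw [if_pos h, if_pos (h2.1 h)]
  · rw [if_neg h, if_neg (fun h' => h (h2.2 h'))]

lemma sum_translate (Λ : Finset (V d)) (a : V d) (η : Config d) (G : Config d → ℝ) :
    ∑ f : ↥Λ → Bool, G (fill Λ f (translate a η)) =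
      ∑ f : ↥(Λ.image (fun x => x + a)) → Bool,
        G (translate a (fill (Λ.image (fun x => x + a)) f η)) := by
  have hm : ∀ y : ↥(Λ.image (fun x => x + a)), y.1 - a ∈ Λ := by
    intro y
    obtain ⟨z, hz, h⟩ := Finset.mem_image.1 y.2
    rw [← h]; simpa using hz
  refine Finset.sum_bij' (fun f _ => fun y => f ⟨y.1 - a, hm y⟩)
    (fun g _ => fun x => g ⟨x.1 + a, Finset.mem_image_of_mem _ x.2⟩) ?_ ?_ ?_ ?_ ?_
  · intro _ _; exact Finset.mem_univ _
  · intro _ _; exact Finset.mem_univ _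
  · intro f _; funext x; simp
  · intro f _; funext x; simp
  · intro f _
    congr 1
    funext x
    unfold fill translate
    by_cases hx : x ∈ Λ
    · simp [hx]
    · simp [hx]

lemma gam_eq (Φ : Interaction d) (Λ : Finset (V d)) (F : Config d → ℝ) (η : Config d) :
    gam Φ Λ F η = (∑ f : ↥Λ → Bool, Real.exp (-(ham Φ Λ (fill Λ f η))) * F (fill Λ f η)) /
      ∑ f : ↥Λ → Bool, Real.exp (-(ham Φ Λ (fill Λ f η))) := by
  unfold gam finGibbs
  rw [Finset.sum_div]
  refine Finset.sum_congr rfl fun f _ => ?_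
  unfold gibbsZ
  ring

lemma gam_translate {Φ : Interaction d} (hΦ : Good Φ) (Λ : Finset (V d)) (a : V d)
    (F : Config d → ℝ) (η : Config d) : gam Φ Λ F (translate a η) =
      gam Φ (Λ.image (fun x => x + a)) (fun ω => F (translate a ω)) η := by
  rw [gam_eq, gam_eq, sum_translate Λ a η (fun ω => Real.exp (-(ham Φ Λ ω)) * F ω),
    sum_translate Λ a η (fun ω => Real.exp (-(ham Φ Λ ω)))]
  simp only [ham_translate hΦ]

/-- global spin flip -/
def gflip (ω : Config d) : Config d := fun x => !(ω x)

lemma ham_gflip {Φ : Interaction d} (hΦ : Good Φ) (Λ : Finset (V d)) (ω : Config d) :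
    ham Φ Λ (gflip ω) = ham Φ Λ ω := by
  unfold ham
  refine tsum_congr fun Δ => ?_
  have : Φ Δ (gflip ω) = Φ Δ ω := hΦ.fl Δ ω
  rw [this]

lemma sum_gflip (Λ : Finset (V d)) (η : Config d) (G : Config d → ℝ) :
    ∑ f : ↥Λ → Bool, G (fill Λ f (gflip η)) = ∑ f : ↥Λ → Bool, G (gflip (fill Λ f η)) := by
  have hinv : Function.Involutive (fun (f : ↥Λ → Bool) (x : ↥Λ) => !(f x)) := by
    intro f; simp
  rw [← Equiv.sum_comp hinv.toPerm]
  refine Finset.sum_congr rfl fun f _ => ?_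
  congr 1
  funext x
  unfold fill gflip
  by_cases hx : x ∈ Λ <;> simp [hx]

lemma gam_gflip {Φ : Interaction d} (hΦ : Good Φ) (Λ : Finset (V d))
    (F : Config d → ℝ) (η : Config d) : gam Φ Λ F (gflip η) =
      gam Φ Λ (fun ω => F (gflip ω)) η := by
  rw [gam_eq, gam_eq, sum_gflip Λ η (fun ω => Real.exp (-(ham Φ Λ ω)) * F ω),
    sum_gflip Λ η (fun ω => Real.exp (-(ham Φ Λ ω)))]
  simp only [ham_gflip hΦ]

lemma gam_abs_le (Φ : Interaction d) (Λ : Finset (V d)) (F : Config d → ℝ) (M : ℝ)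
    (hM : ∀ ω, |F ω| ≤ M) (η : Config d) : |gam Φ Λ F η| ≤ M := by
  unfold gam
  calc _ ≤ ∑ f : ↥Λ → Bool, |finGibbs Φ Λ η f * F (fill Λ f η)| := Finset.abs_sum_le_sum_abs _ _
    _ ≤ ∑ f : ↥Λ → Bool, finGibbs Φ Λ η f * M := by
        refine Finset.sum_le_sum fun f _ => ?_
        rw [abs_mul, abs_of_nonneg (finGibbs_nonneg _ _ _ _)]
        exact mul_le_mul_of_nonneg_left (hM _) (finGibbs_nonneg _ _ _ _)
    _ = M := by rw [← Finset.sum_mul, finGibbs_sum, one_mul]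

/-! ### Part G: infinite volume limit -/

lemma translate_continuous (a : V d) : Continuous (translate a) :=
  continuous_pi fun x => continuous_apply (x + a)

lemma gflip_continuous : Continuous (gflip (d := d)) :=
  continuous_pi fun x => (continuous_of_discreteTopology (f := not)).comp (continuous_apply x)

lemma cont_bdd {F : Config d → ℝ} (hF : Continuous F) : ∃ M, ∀ ω, |F ω| ≤ M := by
  obtain ⟨M, hM⟩ := isCompact_univ.exists_bound_of_continuousOn hF.continuousOn
  exact ⟨M, fun ω => hM ω (Set.mem_univ _)⟩

lemma cont_integrable {F : Config d → ℝ} (hF : Continuous F) (μ : Measure (Config d))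
    [IsFiniteMeasure μ] : Integrable F μ := by
  obtain ⟨M, hM⟩ := cont_bdd hF
  exact Integrable.of_bound hF.aestronglyMeasurable M (ae_of_all _ hM)

lemma discrete_measure {ι : Type*} [Fintype ι] (c : ι → ℝ) (hc : ∀ i, 0 ≤ c i)
    (hc1 : ∑ i, c i = 1) (p : ι → Config d) :
    ∃ ν : ProbabilityMeasure (Config d), ∀ F : Config d → ℝ, Continuous F →
      ∫ ω, F ω ∂(ν : Measure (Config d)) = ∑ i, c i * F (p i) := by
  let μ : Measure (Config d) := ∑ i, ENNReal.ofReal (c i) • Measure.dirac (p i)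
  have hμ : IsProbabilityMeasure μ := by
    constructor
    simp only [μ, Measure.coe_finset_sum, Finset.sum_apply, Measure.smul_apply, smul_eq_mul,
      measure_univ, mul_one]
    rw [← ENNReal.ofReal_sum_of_nonneg (fun i _ => hc i), hc1, ENNReal.ofReal_one]
  refine ⟨⟨μ, hμ⟩, fun F hF => ?_⟩
  change ∫ ω, F ω ∂μ = _
  rw [integral_finset_sum_measure]
  · refine Finset.sum_congr rfl fun i _ => ?_
    rw [integral_smul_measure, integral_dirac, ENNReal.toReal_ofReal (hc i), smul_eq_mul]
  · intro i _
    exact (cont_integrable hF _).smul_measure ENNReal.ofReal_ne_top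

/-- the averaging box -/
def Bx (n : ℕ) : Finset (V d) := Finset.Icc (fun _ => -(n : ℤ)) (fun _ => (n : ℤ))

lemma mem_Bx {n : ℕ} {a : V d} : a ∈ Bx n ↔ ∀ i, -(n : ℤ) ≤ a i ∧ a i ≤ n := by
  unfold Bx
  rw [Finset.mem_Icc]
  exact ⟨fun h i => ⟨h.1 i, h.2 i⟩, fun h => ⟨fun i => (h i).1, fun i => (h i).2⟩⟩

lemma card_Bx (n : ℕ) : (Bx n : Finset (V d)).card = (2 * n + 1) ^ d := by
  unfold Bx
  rw [Pi.card_Icc]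
  simp only [Int.card_Icc, Finset.prod_const, Finset.card_univ, Fintype.card_fin]
  congr 1
  omega

/-- averaged finite volume expectation -/
def Eav (Φ : Interaction d) (n : ℕ) (F : Config d → ℝ) : ℝ :=
  ((Bx n : Finset (V d)).card : ℝ)⁻¹ *
    ∑ a ∈ (Bx n : Finset (V d)), gam Φ (Bx (2 * n)) (fun ω => F (translate a ω)) plusC

lemma Eav_measure (Φ : Interaction d) (n : ℕ) :
    ∃ ν : ProbabilityMeasure (Config d), ∀ F : Config d → ℝ, Continuous F →
      ∫ ω, F ω ∂(ν : Measure (Config d)) = Eav Φ n F := by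
  have hcard : ((Bx n : Finset (V d)).card : ℝ) ≠ 0 := by
    rw [card_Bx]; positivity
  obtain ⟨ν, hν⟩ := discrete_measure
    (ι := ↥(Bx n : Finset (V d)) × (↥(Bx (2 * n) : Finset (V d)) → Bool))
    (fun p => ((Bx n : Finset (V d)).card : ℝ)⁻¹ * finGibbs Φ (Bx (2 * n)) plusC p.2)
    (fun p => mul_nonneg (by positivity) (finGibbs_nonneg _ _ _ _))
    (by
      rw [Fintype.sum_prod_type]
      simp only [← Finset.mul_sum, finGibbs_sum]
      simp only [Finset.sum_const, Finset.card_univ, Fintype.card_coe, nsmul_eq_mul, mul_one]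
      exact inv_mul_cancel₀ hcard)
    (fun p => translate p.1.1 (fill (Bx (2 * n)) p.2 plusC))
  refine ⟨ν, fun F hF => ?_⟩
  rw [hν F hF, Fintype.sum_prod_type]
  unfold Eav gam
  rw [Finset.mul_sum, ← Finset.sum_coe_sort (Bx n : Finset (V d))]
  refine Finset.sum_congr rfl fun a _ => ?_
  rw [Finset.mul_sum]
  refine Finset.sum_congr rfl fun f _ => ?_
  ring

lemma exists_limit (Φ : Interaction d) : ∃ σ : ProbabilityMeasure (Config d),
    ∀ F : Config d → ℝ, Continuous F → Tendsto (fun n => Eav Φ n F) (hyperfilter ℕ : Filter ℕ)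
      (𝓝 (∫ ω, F ω ∂(σ : Measure (Config d)))) := by
  choose ν hν using fun n => Eav_measure (d := d) Φ n
  obtain ⟨σ, -, hσ⟩ := isCompact_univ.ultrafilter_le_nhds ((hyperfilter ℕ).map ν) (by simp)
  refine ⟨σ, fun F hF => ?_⟩
  have ht : Tendsto ν (hyperfilter ℕ : Filter ℕ) (𝓝 σ) := hσ
  have := (ProbabilityMeasure.tendsto_iff_forall_integral_tendsto.1 ht)
    (BoundedContinuousFunction.mkOfCompact ⟨F, hF⟩)
  simpa [hν _ F hF] using this

lemma Eav_consistent {Φ : Interaction d} (hΦ : Good Φ) (Λ : Finset (V d)) (F : Config d → ℝ) :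
    ∀ᶠ n in atTop, Eav Φ n (gam Φ Λ F) = Eav Φ n F := by
  have : ∃ N : ℕ, Λ ⊆ Bx N := by
    refine ⟨Λ.sup (fun x => Finset.univ.sup fun i => (x i).natAbs), fun x hx => ?_⟩
    rw [mem_Bx]
    intro i
    have h1 : (x i).natAbs ≤ Finset.univ.sup fun i => (x i).natAbs :=
      Finset.le_sup (f := fun i => (x i).natAbs) (Finset.mem_univ i)
    have h2 : (Finset.univ.sup fun i => (x i).natAbs) ≤
        Λ.sup (fun x => Finset.univ.sup fun i => (x i).natAbs) :=
      Finset.le_sup (f := fun x : V d => Finset.univ.sup fun i => (x i).natAbs) hx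
    omega
  obtain ⟨N, hN⟩ := this
  filter_upwards [eventually_ge_atTop N] with n hn
  unfold Eav
  congr 1
  refine Finset.sum_congr rfl fun a ha => ?_
  simp only [gam_translate hΦ]
  apply gam_consistent hΦ
  intro y hy
  obtain ⟨x, hx, rfl⟩ := Finset.mem_image.1 hy
  rw [mem_Bx]
  intro i
  have h1 := mem_Bx.1 (hN hx) i
  have h2 := mem_Bx.1 ha i
  simp only [Pi.add_apply]
  push_cast
  constructor <;> linarith [h1.1, h1.2, h2.1, h2.2, (Nat.cast_le (α := ℤ)).2 hn]

lemma translate_translate (a b : V d) (ω : Config d) :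
    translate b (translate a ω) = translate (b + a) ω := by
  funext x; simp [translate, add_assoc]

lemma sum_shift_bound (B I : Finset (V d)) (b : V d) (c : V d → ℝ) (M : ℝ)
    (hM : ∀ a, |c a| ≤ M) (h1 : I ⊆ B) (h2 : I ⊆ B.image (fun a => b + a)) :
    |∑ a ∈ B, c (b + a) - ∑ a ∈ B, c a| ≤ 2 * M * ((B.card : ℝ) - I.card) := by
  classical
  have hinj : Function.Injective (fun a : V d => b + a) := add_right_injective b
  have e : ∑ a ∈ B, c (b + a) = ∑ a ∈ B.image (fun a => b + a), c a := by
    rw [Finset.sum_image (fun x _ y _ h => hinj h)]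
  have hb : ∀ S : Finset (V d), I ⊆ S → |∑ a ∈ S \ I, c a| ≤ M * ((S.card : ℝ) - I.card) := by
    intro S hS
    calc _ ≤ ∑ a ∈ S \ I, |c a| := Finset.abs_sum_le_sum_abs _ _
      _ ≤ ∑ a ∈ S \ I, M := Finset.sum_le_sum fun a _ => hM a
      _ = M * ((S.card : ℝ) - I.card) := by
          rw [Finset.sum_const, nsmul_eq_mul, Finset.card_sdiff_of_subset hS,
            Nat.cast_sub (Finset.card_le_card hS), mul_comm]
  rw [e, ← Finset.sum_sdiff h1, ← Finset.sum_sdiff h2]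
  have hb1 := hb _ h1
  have hb2 := hb _ h2
  rw [Finset.card_image_of_injective _ hinj] at hb2
  rw [abs_le] at hb1 hb2 ⊢
  constructor <;> linarith [hb1.1, hb1.2, hb2.1, hb2.2]

lemma Eav_shift (Φ : Interaction d) (b : V d) {F : Config d → ℝ} (hF : Continuous F) :
    Tendsto (fun n => Eav Φ n (fun ω => F (translate b ω)) - Eav Φ n F) atTop (𝓝 0) := by
  obtain ⟨M, hM⟩ := cont_bdd hF
  obtain ⟨k, hk⟩ : ∃ k : ℕ, ∀ i, (b i).natAbs ≤ k :=
    ⟨Finset.univ.sup fun i => (b i).natAbs,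
      fun i => Finset.le_sup (f := fun i => (b i).natAbs) (Finset.mem_univ i)⟩
  have hlim : Tendsto (fun n : ℕ => 2 * M * (1 - (1 - 2 * (k : ℝ) / ((2 * n + 1 : ℕ) : ℝ)) ^ d))
      atTop (𝓝 0) := by
    have h0 : Tendsto (fun n : ℕ => 2 * (k : ℝ) / ((2 * n + 1 : ℕ) : ℝ)) atTop (𝓝 0) := by
      apply Tendsto.div_atTop tendsto_const_nhds
      apply tendsto_natCast_atTop_atTop.comp
      apply tendsto_atTop_mono (f := fun n : ℕ => n) (fun n => by omega) tendsto_id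
    have := ((((tendsto_const_nhds (x := (1 : ℝ))).sub h0).pow d).const_sub 1).const_mul (2 * M)
    simpa using this
  refine squeeze_zero_norm' ?_ hlim
  filter_upwards [eventually_ge_atTop k] with n hn
  have hcard : (0 : ℝ) < ((Bx n : Finset (V d)).card : ℝ) := by
    rw [card_Bx]; positivity
  have hI1 : (Bx (n - k) : Finset (V d)) ⊆ Bx n := by
    intro x hx
    rw [mem_Bx] at hx ⊢
    intro i
    have := hx i
    omega
  have hI2 : (Bx (n - k) : Finset (V d)) ⊆ (Bx n).image (fun a => b + a) := by
    intro x hx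
    rw [mem_Bx] at hx
    refine Finset.mem_image.2 ⟨x - b, mem_Bx.2 fun i => ?_, by simp⟩
    have h1 := hx i
    have h2 := hk i
    simp only [Pi.sub_apply]
    omega
  have hs := sum_shift_bound (Bx n) (Bx (n - k)) b
    (fun a => gam Φ (Bx (2 * n)) (fun ω => F (translate a ω)) plusC) M
    (fun a => gam_abs_le _ _ _ M (fun ω => hM _) _) hI1 hI2
  have e : Eav Φ n (fun ω => F (translate b ω)) - Eav Φ n F =
      ((Bx n : Finset (V d)).card : ℝ)⁻¹ *
      (∑ a ∈ (Bx n : Finset (V d)), gam Φ (Bx (2 * n)) (fun ω => F (translate (b + a) ω)) plusC -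
      ∑ a ∈ (Bx n : Finset (V d)), gam Φ (Bx (2 * n)) (fun ω => F (translate a ω)) plusC) := by
    unfold Eav
    simp only [translate_translate]
    ring
  rw [e, Real.norm_eq_abs, abs_mul, abs_of_pos (inv_pos.2 hcard), inv_mul_le_iff₀ hcard]
  refine hs.trans (le_of_eq ?_)
  rw [card_Bx, card_Bx]
  have hpos : ((2 * n + 1 : ℕ) : ℝ) ≠ 0 := by positivity
  have e2 : (1 - 2 * (k : ℝ) / ((2 * n + 1 : ℕ) : ℝ)) =
      ((2 * (n - k) + 1 : ℕ) : ℝ) / ((2 * n + 1 : ℕ) : ℝ) := by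
    rw [eq_div_iff hpos, sub_mul, div_mul_cancel₀ _ hpos]
    push_cast [Nat.cast_sub hn]
    ring
  rw [e2, div_pow, Nat.cast_pow, Nat.cast_pow]
  field_simp

/-- DLR equations in functional form -/
def DLRf (Φ : Interaction d) (σ : Measure (Config d)) : Prop :=
  ∀ (Λ : Finset (V d)) (F : Config d → ℝ), Continuous F → ∫ ω, gam Φ Λ F ω ∂σ = ∫ ω, F ω ∂σ

open scoped Classical in
lemma cyl_ind_eq (Λ : Finset (V d)) (f : ↥Λ → Bool) (ω : Config d) :
    (cyl Λ f).indicator (fun _ => (1 : ℝ)) ω = if (fun x : ↥Λ => ω x.1) = f then 1 else 0 := by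
  rw [Set.indicator_apply]
  congr 1
  simp only [cyl, Set.mem_ofPred_eq, funext_iff, Subtype.forall]

lemma cyl_ind_cont (Λ : Finset (V d)) (f : ↥Λ → Bool) :
    Continuous ((cyl Λ f).indicator (fun _ => (1 : ℝ))) := by
  classical
  have : (cyl Λ f).indicator (fun _ => (1 : ℝ)) =
      (fun g : ↥Λ → Bool => if g = f then (1 : ℝ) else 0) ∘ (fun ω x => ω x.1) := by
    funext ω
    rw [cyl_ind_eq]; rfl
  rw [this]
  exact continuous_of_discreteTopology.comp (continuous_pi fun x => continuous_apply x.1)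

lemma cyl_meas (Λ : Finset (V d)) (f : ↥Λ → Bool) : MeasurableSet (cyl Λ f) := by
  have : cyl Λ f = (cyl Λ f).indicator (fun _ => (1 : ℝ)) ⁻¹' {1} := by
    ext ω
    by_cases h : ω ∈ cyl Λ f <;> simp [h]
  rw [this]
  exact (cyl_ind_cont Λ f).measurable (measurableSet_singleton _)

lemma gam_cyl (Φ : Interaction d) (Λ : Finset (V d)) (f : ↥Λ → Bool) (η : Config d) :
    gam Φ Λ ((cyl Λ f).indicator (fun _ => (1 : ℝ))) η = finGibbs Φ Λ η f := by
  classical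
  unfold gam
  have : ∀ g : ↥Λ → Bool, (fun x : ↥Λ => fill Λ g η x.1) = g := by
    intro g; funext x; simp [fill]
  simp only [cyl_ind_eq, this, mul_ite, mul_one, mul_zero]
  simp

lemma isGibbs_of_DLRf {Φ : Interaction d} {σ : Measure (Config d)} [hσ : IsProbabilityMeasure σ]
    (h : DLRf Φ σ) : IsGibbs Φ σ := by
  refine ⟨hσ, fun Λ => ⟨σ, hσ, fun f => ?_⟩⟩
  have := h Λ _ (cyl_ind_cont Λ f)
  simp only [gam_cyl] at this
  rw [this, integral_indicator_const _ (cyl_meas Λ f)]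
  simp [Measure.real]

lemma transInv_of_int {σ : Measure (Config d)} [IsProbabilityMeasure σ]
    (h : ∀ (b : V d) (F : Config d → ℝ), Continuous F →
      ∫ ω, F (translate b ω) ∂σ = ∫ ω, F ω ∂σ) : MeasTransInv σ := by
  intro b
  have hm : Measurable (translate (d := d) b) := (translate_continuous b).measurable
  have : IsProbabilityMeasure (σ.map (translate b)) :=
    Measure.isProbabilityMeasure_map hm.aemeasurable
  apply ext_of_forall_integral_eq_of_IsFiniteMeasure
  intro F
  rw [integral_map hm.aemeasurable F.continuous.aestronglyMeasurable]
  exact h b F F.continuous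

/-- indicator of a minus spin at the origin -/
def F0 (ω : Config d) : ℝ := if ω 0 = false then 1 else 0

lemma F0_cont : Continuous (F0 (d := d)) :=
  (continuous_of_discreteTopology (f := fun b : Bool => if b = false then (1 : ℝ) else 0)).comp
    (continuous_apply (0 : V d))

theorem main_aux (i0 i1 : Fin d) (h01 : i0 ≠ i1) (β : ℝ) {Ψ : Interaction d} (h1 : IsLocal Ψ)
    (h2 : TransInv Ψ) (h3 : SpinFlipSymm Ψ) (h4 : DSummable' Ψ)
    (hq : 2 * ((3 ^ d * d : ℕ) : ℝ) ^ 2 * Real.exp (-(2 * (β - dnorm' Ψ))) ≤ 1 / 8) :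
    ∃ σ₁ σ₂ : Measure (Config d), σ₁ ≠ σ₂ ∧
          IsGibbs (Iadd (ising β) Ψ) σ₁ ∧ MeasTransInv σ₁ ∧
          IsGibbs (Iadd (ising β) Ψ) σ₂ ∧ MeasTransInv σ₂ := by
  have hG := good_add β h1 h2 h3 h4
  have hpei := peierls i0 i1 h01 β h1 h2 h3 h4 hq
  set Φ := Iadd (ising β) Ψ with hΦ
  obtain ⟨σ', hσ'⟩ := exists_limit Φ
  have hle : (hyperfilter ℕ : Filter ℕ) ≤ atTop := Nat.hyperfilter_le_atTop
  obtain ⟨σ, hσ⟩ := σ'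
  simp only [ProbabilityMeasure.coe_mk] at hσ'
  have hD : DLRf Φ σ := by
    intro Λ F hF
    have t1 := hσ' _ (gam_continuous hG Λ hF)
    have t2 := hσ' F hF
    exact tendsto_nhds_unique (t1.congr' (hle (Eav_consistent hG Λ F))) t2
  have hT : ∀ (b : V d) (F : Config d → ℝ), Continuous F →
      ∫ ω, F (translate b ω) ∂σ = ∫ ω, F ω ∂σ := by
    intro b F hF
    have t1 := hσ' _ (hF.comp (translate_continuous b))
    have t2 := hσ' F hF
    have t3 := (Eav_shift Φ b hF).mono_left hle
    exact sub_eq_zero.1 (tendsto_nhds_unique (t1.sub t2) t3)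
  have hP : ∫ ω, F0 ω ∂σ ≤ 1 / 4 := by
    refine le_of_tendsto (hσ' F0 F0_cont) (Eventually.of_forall fun n => ?_)
    have hcard : (0 : ℝ) < ((Bx n : Finset (V d)).card : ℝ) := by
      rw [card_Bx]; positivity
    unfold Eav
    rw [inv_mul_le_iff₀ hcard]
    calc _ ≤ ∑ a ∈ (Bx n : Finset (V d)), (1 / 4 : ℝ) := by
          refine Finset.sum_le_sum fun a _ => ?_
          refine le_trans (le_of_eq ?_) (hpei (fun _ => -((2 * n : ℕ) : ℤ))
            (fun _ => ((2 * n : ℕ) : ℤ)) a)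
          unfold gam F0 Bx translate
          refine Finset.sum_congr rfl fun f _ => ?_
          rw [zero_add, mul_ite, mul_one, mul_zero]
      _ = _ := by rw [Finset.sum_const, nsmul_eq_mul]
  have hm : Measurable (gflip (d := d)) := gflip_continuous.measurable
  have hσ2 : IsProbabilityMeasure (σ.map gflip) := Measure.isProbabilityMeasure_map hm.aemeasurable
  have hmapInt : ∀ F : Config d → ℝ, Continuous F → ∫ ω, F ω ∂(σ.map gflip) = ∫ ω, F (gflip ω) ∂σ :=
    fun F hF => integral_map hm.aemeasurable hF.aestronglyMeasurable
  refine ⟨σ, σ.map gflip, ?_, isGibbs_of_DLRf hD, transInv_of_int hT, isGibbs_of_DLRf ?_,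
    transInv_of_int ?_⟩
  · intro heq
    have e1 := hmapInt F0 F0_cont
    rw [← heq] at e1
    have e2 : ∀ ω : Config d, F0 (gflip ω) = 1 - F0 ω := by
      intro ω
      unfold F0 gflip
      cases ω 0 <;> simp
    simp only [e2] at e1
    rw [integral_sub (integrable_const _) (cont_integrable F0_cont σ)] at e1
    simp at e1
    linarith
  · intro Λ F hF
    rw [hmapInt _ (gam_continuous hG Λ hF), hmapInt F hF]
    simp only [gam_gflip hG]
    exact hD Λ _ (hF.comp gflip_continuous)
  · intro b F hF
    rw [hmapInt (fun ω => F (translate b ω)) (hF.comp (translate_continuous b)), hmapInt F hF]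
    exact hT b (fun ω => F (gflip ω)) (hF.comp gflip_continuous)

theorem coexistence_aux (d : ℕ) (hd : 2 ≤ d) :
    ∃ L > (0:ℝ), ∀ β δ : ℝ, 0 < β → 0 < δ → L < β - δ →
      ∀ Ψ : Interaction d, IsLocal Ψ → TransInv Ψ → SpinFlipSymm Ψ →
        DSummable' Ψ → dnorm' Ψ < δ →
        ∃ σ₁ σ₂ : Measure (Config d), σ₁ ≠ σ₂ ∧
          IsGibbs (Iadd (ising β) Ψ) σ₁ ∧ MeasTransInv σ₁ ∧
          IsGibbs (Iadd (ising β) Ψ) σ₂ ∧ MeasTransInv σ₂ := by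
  set K : ℝ := 2 * ((3 ^ d * d : ℕ) : ℝ) ^ 2 with hK
  have hK0 : 0 ≤ K := by positivity
  refine ⟨8 * K + 1, by linarith, ?_⟩
  intro β δ _ _ hL Ψ h1 h2 h3 h4 h5
  refine main_aux ⟨0, by omega⟩ ⟨1, by omega⟩ (by simp) β h1 h2 h3 h4 ?_
  rw [← hK, Real.exp_neg, ← div_eq_mul_inv, div_le_iff₀ (Real.exp_pos _)]
  have := Real.add_one_le_exp (2 * (β - dnorm' Ψ))
  linarith
/-- There exists `0 < L < ∞` such that whenever `β, δ > 0` satisfy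
`β - δ > L`, for every translation invariant, spin-flip symmetric interaction `Ψ` with
`|||Ψ|||' < δ`, the interaction `Φ = Φ^β + Ψ` has at least two distinct
translation-invariant Gibbs states. -/
theorem coexistence_dnorm' (d : ℕ) (hd : 2 ≤ d) :
    ∃ L > (0:ℝ), ∀ β δ : ℝ, 0 < β → 0 < δ → L < β - δ →
      ∀ Ψ : Interaction d, IsLocal Ψ → TransInv Ψ → SpinFlipSymm Ψ →
        DSummable' Ψ → dnorm' Ψ < δ →
        ∃ σ₁ σ₂ : Measure (Config d), σ₁ ≠ σ₂ ∧
          IsGibbs (Iadd (ising β) Ψ) σ₁ ∧ MeasTransInv σ₁ ∧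
          IsGibbs (Iadd (ising β) Ψ) σ₂ ∧ MeasTransInv σ₂ := by
  exact coexistence_aux d hd

end
end Ising
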